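/- arXiv:1903.00247 — 3 statements merged into one kernel-verified Lean document; each statement's English description precedes it below -/
import Mathlib

section
/- Fix d ≥ 1 and reals p_j > 0 (j = 1,…,d) with Σ_{j=1}^d p_j ≤ 1, and let a_k ∈ (0,1) for k = 1,…,d. Let P be the matrix on E = {0,1}^d with P(i, i+s_k) = a_k·p_k when i_k = 0, P(i, i−s_k) = (1−a_k)·p_k when i_k = 1, P(i,i) = 1 − Σ_{j: i_j=0} a_j p_j − Σ_{j: i_j=1} (1−a_j) p_j, other entries 0. Then the characteristic polynomial of P equals ∏_{i ∈ {0,1}^d} (X − (1 − Σ_{j: i_j = 0} p_j)). In particular, every eigenvalue of P is of the form 1 − Σ_{k∈A} p_k for some subset A ⊆ {1,…,d}, and these eigenvalues do not depend on the a_k. -/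
open Matrix Finset Polynomial
open scoped Classical

/-- The hypercube `{0,1}^d`. -/
abbrev Cube (d : ℕ) : Type := Fin d → Fin 2

/-- The antidual chain of Theorem 4 on `{0,1}^d`. -/
noncomputable def cubeAntidual (d : ℕ) (p a : Fin d → ℝ) : Matrix (Cube d) (Cube d) ℝ :=
  fun i i' =>
    (∑ k : Fin d, if (i k : ℕ) = 0 ∧ (i' k : ℕ) = 1 ∧ (∀ j, j ≠ k → i' j = i j)
        then a k * p k else 0) +
    (∑ k : Fin d, if (i k : ℕ) = 1 ∧ (i' k : ℕ) = 0 ∧ (∀ j, j ≠ k → i' j = i j)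
        then (1 - a k) * p k else 0) +
    (if i' = i
        then 1 - ∑ j : Fin d, (if (i j : ℕ) = 0 then a j * p j else (1 - a j) * p j)
        else 0)

/-- One-coordinate right eigenvectors (columns). -/
noncomputable def cubeU1 (a : ℝ) : Matrix (Fin 2) (Fin 2) ℝ := !![a, 1; -(1 - a), 1]

/-- Inverse of `cubeU1`. -/
noncomputable def cubeV1 (a : ℝ) : Matrix (Fin 2) (Fin 2) ℝ := !![1, -1; 1 - a, a]

/-- Tensor product of the one-coordinate eigenvector matrices. -/
noncomputable def cubeU (d : ℕ) (a : Fin d → ℝ) : Matrix (Cube d) (Cube d) ℝ :=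
  fun i m => ∏ j, cubeU1 (a j) (i j) (m j)

/-- Inverse of `cubeU`. -/
noncomputable def cubeV (d : ℕ) (a : Fin d → ℝ) : Matrix (Cube d) (Cube d) ℝ :=
  fun i m => ∏ j, cubeV1 (a j) (i j) (m j)

lemma cubeV1_mul (a : ℝ) : cubeV1 a * cubeU1 a = 1 := by
  ext i j
  fin_cases i <;> fin_cases j <;> simp [cubeV1, cubeU1, Matrix.mul_apply] <;> ring

lemma cubeV_mul (d : ℕ) (a : Fin d → ℝ) : cubeV d a * cubeU d a = 1 := by
  ext i m
  have h : (cubeV d a * cubeU d a) i m = ∏ j, (cubeV1 (a j) * cubeU1 (a j)) (i j) (m j) := by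
    simp only [Matrix.mul_apply, cubeV, cubeU, ← Finset.prod_mul_distrib]
    rw [Finset.prod_univ_sum]
    simp
  rw [h]
  simp only [cubeV1_mul, Matrix.one_apply]
  by_cases him : i = m
  · simp [him]
  · rw [if_neg him]
    obtain ⟨j, hj⟩ := Function.ne_iff.mp him
    exact Finset.prod_eq_zero (Finset.mem_univ j) (if_neg hj)

lemma cubeU_update (d : ℕ) (a : Fin d → ℝ) (i m : Cube d) (k : Fin d) (x : Fin 2) :
    cubeU d a (Function.update i k x) m =
      cubeU1 (a k) x (m k) * ∏ j ∈ Finset.univ.erase k, cubeU1 (a j) (i j) (m j) := by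
  unfold cubeU
  rw [← Finset.mul_prod_erase Finset.univ _ (Finset.mem_univ k)]
  congr 1
  · simp
  · refine Finset.prod_congr rfl fun j hj => ?_
    rw [Function.update_of_ne (Finset.ne_of_mem_erase hj)]

lemma cube_cond (d : ℕ) (i i' : Cube d) (k : Fin d) (x : Fin 2) :
    ((i' k : ℕ) = (x : ℕ) ∧ (∀ j, j ≠ k → i' j = i j)) ↔ i' = Function.update i k x := by
  rw [Function.eq_update_iff, Fin.ext_iff]

lemma cubeAntidual_eq (d : ℕ) (p a : Fin d → ℝ) (i i' : Cube d) :
    cubeAntidual d p a i i' =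
      (∑ k : Fin d, if i' = Function.update i k 1 then
        (if i k = 0 then a k * p k else 0) else 0) +
      (∑ k : Fin d, if i' = Function.update i k 0 then
        (if i k = 0 then 0 else (1 - a k) * p k) else 0) +
      (if i' = i
        then 1 - ∑ j : Fin d, (if i j = 0 then a j * p j else (1 - a j) * p j)
        else 0) := by
  have h0 : ∀ x : Fin 2, (x : ℕ) = 0 ↔ x = 0 := by decide
  have h1 : ∀ x : Fin 2, (x : ℕ) = 1 ↔ ¬ x = 0 := by decide
  unfold cubeAntidual
  congr 1
  · congr 1
    · refine Finset.sum_congr rfl fun k _ => ?_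
      have := cube_cond d i i' k 1
      simp only [Fin.val_one] at this
      simp only [this, h0]
      split_ifs <;> tauto
    · refine Finset.sum_congr rfl fun k _ => ?_
      have := cube_cond d i i' k 0
      simp only [Fin.val_zero] at this
      simp only [this, h1]
      split_ifs <;> tauto
  · simp only [h0]

lemma cube_mul (d : ℕ) (p a : Fin d → ℝ) :
    cubeAntidual d p a * cubeU d a = cubeU d a *
      Matrix.diagonal (fun m : Cube d => 1 - ∑ j, if (m j : ℕ) = 0 then p j else 0) := by
  have h0 : ∀ x : Fin 2, (x : ℕ) = 0 ↔ x = 0 := by decide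
  ext i m
  rw [Matrix.mul_diagonal, Matrix.mul_apply]
  simp only [cubeAntidual_eq, add_mul, Finset.sum_add_distrib, Finset.sum_mul, ite_mul, zero_mul,
    h0]
  rw [Finset.sum_comm]
  conv_lhs =>
    enter [1, 2]
    rw [Finset.sum_comm]
  simp only [Finset.sum_ite_eq', Finset.sum_ite_eq, Finset.mem_univ, if_true]
  rw [← sub_eq_zero]
  have key : ∀ k : Fin d,
      (if i k = 0 then a k * p k * cubeU d a (Function.update i k 1) m else 0) +
      (if i k = 0 then 0 else (1 - a k) * p k * cubeU d a (Function.update i k 0) m) -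
      (if i k = 0 then a k * p k else (1 - a k) * p k) * cubeU d a i m +
      cubeU d a i m * (if m k = 0 then p k else 0) = 0 := by
    intro k
    have h := cubeU_update d a i m k (i k)
    rw [Function.update_eq_self] at h
    rw [h, cubeU_update, cubeU_update]
    generalize ∏ j ∈ Finset.univ.erase k, cubeU1 (a j) (i j) (m j) = R
    generalize i k = x
    generalize m k = y
    fin_cases x <;> fin_cases y <;> simp [cubeU1] <;> ring
  have hs := Finset.sum_eq_zero (s := Finset.univ) (fun k _ => key k)
  rw [Finset.sum_add_distrib, Finset.sum_sub_distrib, Finset.sum_add_distrib,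
    ← Finset.sum_mul, ← Finset.mul_sum] at hs
  linear_combination hs

/-- The eigenvalues of the hypercube antidual chain are `1 - Σ_{k∈A} p_k`,
`A ⊆ {1,…,d}`, and they do not depend on the `a_k`. -/
theorem stmt11 (d : ℕ) (hd : 1 ≤ d) (p a : Fin d → ℝ)
    (hp : ∀ j, 0 < p j) (hpsum : ∑ j, p j ≤ 1)
    (ha : ∀ k, 0 < a k ∧ a k < 1) :
    (cubeAntidual d p a).charpoly =
      ∏ i : Cube d,
        (Polynomial.X - Polynomial.C (1 - ∑ j, if (i j : ℕ) = 0 then p j else 0)) ∧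
    ∀ x : ℝ, (cubeAntidual d p a).charpoly.IsRoot x →
      ∃ A : Finset (Fin d), x = 1 - ∑ k ∈ A, p k := by
  have hc : (cubeAntidual d p a).charpoly =
      ∏ i : Cube d,
        (Polynomial.X - Polynomial.C (1 - ∑ j, if (i j : ℕ) = 0 then p j else 0)) := by
    have hVU := cubeV_mul d a
    have hUV : cubeU d a * cubeV d a = 1 := mul_eq_one_comm.mp hVU
    have hP : cubeAntidual d p a = cubeU d a *
        (Matrix.diagonal (fun m : Cube d => 1 - ∑ j, if (m j : ℕ) = 0 then p j else 0) *
          cubeV d a) := by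
      rw [← Matrix.mul_assoc, ← cube_mul, Matrix.mul_assoc, hUV, Matrix.mul_one]
    rw [hP, Matrix.charpoly_mul_comm, Matrix.mul_assoc, hVU, Matrix.mul_one,
      Matrix.charpoly_diagonal]
  refine ⟨hc, fun x hx => ?_⟩
  rw [hc, Polynomial.IsRoot.def, Polynomial.eval_prod, Finset.prod_eq_zero_iff] at hx
  obtain ⟨i, _, hi⟩ := hx
  refine ⟨Finset.univ.filter (fun j => (i j : ℕ) = 0), ?_⟩
  rw [Finset.sum_filter]
  simp only [Polynomial.eval_sub, Polynomial.eval_X, Polynomial.eval_C] at hi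
  linarith
end

section
/- Let m ≥ 1, reals 0 < λ_1 < λ_2 < … < λ_m and 0 = n_0 < n_1 < … < n_m = 1 with Σ_{i=1}^m λ_i·(n_i − n_{i−1}) = 1, and let f : [0,1] → ℝ be the piecewise constant probability density f(y) = λ_i for n_{i−1} < y ≤ n_i. For each d ≥ 1 set p^{(d)}_k := ∫_{(k−1)/d}^{k/d} f(y) dy for k = 1,…,d (so Σ_k p^{(d)}_k = 1), let a^{(d)}_k ∈ (0,1) be arbitrary, and let P_{(d)} be the matrix on {0,1}^d with P_{(d)}(i, i+s_k) = a^{(d)}_k·p^{(d)}_k when i_k = 0, P_{(d)}(i, i−s_k) = (1−a^{(d)}_k)·p^{(d)}_k when i_k = 1, P_{(d)}(i,i) = 1 − Σ_{j: i_j=0} a^{(d)}_j p^{(d)}_j − Σ_{j: i_j=1} (1−a^{(d)}_j) p^{(d)}_j, other entries 0; let π_{(d)}(i) := ∏_{j=1}^d (a^{(d)}_j if i_j = 1, else 1−a^{(d)}_j) and sep_d(n) := sep(δ₀ P_{(d)}ⁿ, π_{(d)}). Then the sequence exhibits a separation cutoff at time t_d = (d/λ_1)·(log d − log n_1) with window size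 w_d = d/λ_1: lim_{c→+∞} limsup_{d→∞} sep_d(⌈t_d + c·w_d⌉) = 0 and lim_{c→+∞} liminf_{d→∞} sep_d(⌊t_d − c·w_d⌋₊) = 1, where log is the natural logarithm, ⌈x⌉ is the least integer ≥ x, and ⌊x⌋₊ := max(⌊x⌋, 0). -/
open Matrix Finset Filter MeasureTheory
open scoped Classical

/-- The product-form stationary distribution `π(i) = ∏_j (a_j if i_j = 1 else 1 - a_j)`. -/
noncomputable def cubePi (d : ℕ) (a : Fin d → ℝ) : Cube d → ℝ :=
  fun i => ∏ j, (if (i j : ℕ) = 1 then a j else 1 - a j)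

/-- Separation: `sep(μ,π) = max_e (1 - μ(e)/π(e))`. -/
noncomputable def sep {E : Type*} [Fintype E] [Nonempty E] (μ π : E → ℝ) : ℝ :=
  Finset.univ.sup' Finset.univ_nonempty fun e => 1 - μ e / π e

/-- The piecewise constant density `f(y) = λ_i` for `n_{i−1} < y ≤ n_i`, `1 ≤ i ≤ m`. -/
noncomputable def pieceF (m : ℕ) (lam nn : ℕ → ℝ) : ℝ → ℝ :=
  fun y => ∑ i ∈ Finset.range m, if nn i < y ∧ y ≤ nn (i + 1) then lam (i + 1) else 0

/-- `p^{(d)}_k = ∫_{(k−1)/d}^{k/d} f(y) dy` (here `k : Fin d` is the `(k+1)`-st coupon). -/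
noncomputable def pInt (m : ℕ) (lam nn : ℕ → ℝ) (d : ℕ) (k : Fin d) : ℝ :=
  ∫ y in Set.Ioc ((k : ℝ) / d) (((k : ℝ) + 1) / d), pieceF m lam nn y

/-- Separation distance at time `n` of the antidual chain with sampling
probabilities `p^{(d)}_k`, started at `(0,…,0)`. -/
noncomputable def sepPC (m : ℕ) (lam nn : ℕ → ℝ) (a : (d : ℕ) → Fin d → ℝ)
    (d : ℕ) (n : ℕ) : ℝ :=
  sep ((fun i : Cube d => if i = 0 then (1 : ℝ) else 0) ᵥ*
        (cubeAntidual d (pInt m lam nn d) (a d)) ^ n)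
      (cubePi d (a d))

/-- Single-coordinate stationary weight. -/
noncomputable def ccQ (x : ℝ) (v : Fin 2) : ℝ := if (v : ℕ) = 1 then x else 1 - x

/-- Distribution on the cube given that the set `S` of coordinates has been refreshed. -/
noncomputable def ccNu (d : ℕ) (a : Fin d → ℝ) (S : Finset (Fin d)) (i : Cube d) : ℝ :=
  ∏ j, (if j ∈ S then ccQ (a j) (i j) else if i j = 0 then 1 else 0)

/-- One step of coupon collecting, acting on functions of the collected set. -/
noncomputable def ccA (d : ℕ) (p : Fin d → ℝ) (F : Finset (Fin d) → ℝ) : Finset (Fin d) → ℝ :=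
  fun S => ∑ k, p k * F (insert k S)

lemma cc_matrix (d : ℕ) (p a : Fin d → ℝ) (hp : ∑ k, p k = 1) (i i' : Cube d) :
    cubeAntidual d p a i i' =
      ∑ k, p k * (if (∀ j, j ≠ k → i' j = i j) then ccQ (a k) (i' k) else 0) := by
  unfold cubeAntidual
  have h1 : (if i' = i
        then 1 - ∑ j : Fin d, (if (i j : ℕ) = 0 then a j * p j else (1 - a j) * p j)
        else 0) = ∑ k, if i' = i then p k * ccQ (a k) (i k) else 0 := by
    split_ifs with h
    · have e : (1 : ℝ) - ∑ j : Fin d, (if (i j : ℕ) = 0 then a j * p j else (1 - a j) * p j) =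
          ∑ k, p k - ∑ j : Fin d, (if (i j : ℕ) = 0 then a j * p j else (1 - a j) * p j) := by
        rw [hp]
      rw [e, ← Finset.sum_sub_distrib]
      refine Finset.sum_congr rfl fun k _ => ?_
      unfold ccQ
      generalize i k = v
      fin_cases v <;> simp <;> ring
    · simp
  rw [h1, ← Finset.sum_add_distrib, ← Finset.sum_add_distrib]
  refine Finset.sum_congr rfl fun k _ => ?_
  have h2 : (i' = i) ↔ (i' k = i k ∧ ∀ j, j ≠ k → i' j = i j) := by
    constructor
    · rintro rfl; simp
    · rintro ⟨h, h'⟩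
      funext j
      by_cases hj : j = k
      · rw [hj, h]
      · exact h' j hj
  simp only [h2]
  by_cases h : ∀ j, j ≠ k → i' j = i j
  · simp only [ccQ]
    generalize i k = v
    generalize i' k = w
    fin_cases v <;> fin_cases w <;> simp <;> ring_nf
  · simp [h]

lemma cc_step (d : ℕ) (p a : Fin d → ℝ) (hp : ∑ k, p k = 1) (S : Finset (Fin d)) :
    ccNu d a S ᵥ* cubeAntidual d p a = fun i => ∑ k, p k * ccNu d a (insert k S) i := by
  funext i'
  simp only [Matrix.vecMul, dotProduct, cc_matrix d p a hp, Finset.mul_sum]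
  rw [Finset.sum_comm]
  refine Finset.sum_congr rfl fun k _ => ?_
  have h1 : ∀ i : Cube d, ccNu d a S i *
      (p k * (if (∀ j, j ≠ k → i' j = i j) then ccQ (a k) (i' k) else 0)) =
      if (∀ j, j ≠ k → i' j = i j) then ccNu d a S i * (p k * ccQ (a k) (i' k)) else 0 := by
    intro i; split_ifs <;> simp
  simp only [h1]
  rw [← Finset.sum_filter]
  have h2 : (Finset.univ.filter fun i : Cube d => ∀ j, j ≠ k → i' j = i j) =
      Finset.univ.image (fun v : Fin 2 => Function.update i' k v) := by
    ext i
    simp only [Finset.mem_filter, Finset.mem_univ, true_and, Finset.mem_image]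
    constructor
    · intro h
      refine ⟨i k, ?_⟩
      funext j
      by_cases hj : j = k
      · subst hj; simp
      · simp [hj, h j hj]
    · rintro ⟨v, rfl⟩ j hj
      simp [hj]
  rw [h2, Finset.sum_image (by intro v _ w _ h; exact Function.update_injective i' k h)]
  rw [← Finset.sum_mul]
  have h3 : ∀ (T : Finset (Fin d)) (i : Cube d), ccNu d a T i =
      (if k ∈ T then ccQ (a k) (i k) else if i k = 0 then 1 else 0) *
      ∏ j ∈ Finset.univ.erase k,
        (if j ∈ T then ccQ (a j) (i j) else if i j = 0 then 1 else 0) := by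
    intro T i
    unfold ccNu
    exact (Finset.mul_prod_erase Finset.univ
      (fun j => if j ∈ T then ccQ (a j) (i j) else if i j = 0 then 1 else 0)
      (Finset.mem_univ k)).symm
  have h4 : ∀ v : Fin 2, ccNu d a S (Function.update i' k v) =
      (if k ∈ S then ccQ (a k) v else if v = 0 then 1 else 0) *
      ∏ j ∈ Finset.univ.erase k,
        (if j ∈ S then ccQ (a j) (i' j) else if i' j = 0 then 1 else 0) := by
    intro v
    rw [h3]
    congr 1
    · simp
    · refine Finset.prod_congr rfl fun j hj => ?_
      have : j ≠ k := (Finset.mem_erase.mp hj).1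
      simp [this]
  have h5 : ccNu d a (insert k S) i' = ccQ (a k) (i' k) *
      ∏ j ∈ Finset.univ.erase k,
        (if j ∈ S then ccQ (a j) (i' j) else if i' j = 0 then 1 else 0) := by
    rw [h3]
    congr 1
    · simp
    · refine Finset.prod_congr rfl fun j hj => ?_
      have : j ≠ k := (Finset.mem_erase.mp hj).1
      simp [this]
  simp only [h4]
  rw [h5, ← Finset.sum_mul]
  have h6 : ∑ v : Fin 2, (if k ∈ S then ccQ (a k) v else if v = 0 then 1 else 0) = (1:ℝ) := by
    split_ifs <;> simp [Fin.sum_univ_two, ccQ]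
  rw [h6]; ring

lemma cc_pow (d : ℕ) (p a : Fin d → ℝ) (hp : ∑ k, p k = 1) (n : ℕ) (i : Cube d) :
    ∀ S : Finset (Fin d), (ccNu d a S ᵥ* (cubeAntidual d p a) ^ n) i =
      ((ccA d p)^[n] (fun S => ccNu d a S i)) S := by
  induction n with
  | zero => intro S; simp
  | succ n ih =>
    intro S
    rw [pow_succ', ← Matrix.vecMul_vecMul, cc_step d p a hp, Function.iterate_succ_apply']
    have : (fun i => ∑ k, p k * ccNu d a (insert k S) i) =
        ∑ k, p k • ccNu d a (insert k S) := by
      funext i; simp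
    rw [this, Matrix.sum_vecMul]
    simp only [Matrix.smul_vecMul, Finset.sum_apply, Pi.smul_apply, smul_eq_mul, ih]
    rfl

section ops
variable (d : ℕ) (p : Fin d → ℝ)

lemma ccA_mono (hp0 : ∀ k, 0 ≤ p k) (n : ℕ) {F G : Finset (Fin d) → ℝ} (h : ∀ S, F S ≤ G S) :
    ∀ S, ((ccA d p)^[n] F) S ≤ ((ccA d p)^[n] G) S := by
  induction n with
  | zero => simpa using h
  | succ n ih =>
    intro S
    rw [Function.iterate_succ_apply', Function.iterate_succ_apply']
    exact Finset.sum_le_sum fun k _ => mul_le_mul_of_nonneg_left (ih _) (hp0 k)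

lemma ccA_smul (n : ℕ) (c : ℝ) (F : Finset (Fin d) → ℝ) :
    (ccA d p)^[n] (fun S => c * F S) = fun S => c * ((ccA d p)^[n] F) S := by
  induction n with
  | zero => rfl
  | succ n ih =>
    rw [Function.iterate_succ_apply', Function.iterate_succ_apply', ih]
    funext S
    simp only [ccA, Finset.mul_sum]
    exact Finset.sum_congr rfl fun k _ => by ring

lemma ccA_add (n : ℕ) (F G : Finset (Fin d) → ℝ) :
    (ccA d p)^[n] (fun S => F S + G S) =
      fun S => ((ccA d p)^[n] F) S + ((ccA d p)^[n] G) S := by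
  induction n with
  | zero => rfl
  | succ n ih =>
    rw [Function.iterate_succ_apply', Function.iterate_succ_apply',
      Function.iterate_succ_apply', ih]
    funext S
    simp only [ccA, mul_add, Finset.sum_add_distrib]

lemma ccA_zero (n : ℕ) : (ccA d p)^[n] (fun _ => 0) = fun _ => 0 := by
  have := ccA_smul d p n 0 (fun _ => 0)
  simpa using this

lemma ccA_sum {ι : Type} (n : ℕ) (s : Finset ι) (F : ι → Finset (Fin d) → ℝ) :
    (ccA d p)^[n] (fun S => ∑ x ∈ s, F x S) = fun S => ∑ x ∈ s, ((ccA d p)^[n] (F x)) S := by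
  induction s using Finset.induction_on with
  | empty => simpa using ccA_zero d p n
  | insert x s hx ih =>
    simp only [Finset.sum_insert hx]
    rw [ccA_add, ih]

/-- Indicator that no coupon of `B` is collected. -/
noncomputable def ccH (B S : Finset (Fin d)) : ℝ := if Disjoint B S then 1 else 0

lemma ccA_H (hp : ∑ k, p k = 1) (n : ℕ) (B : Finset (Fin d)) :
    (ccA d p)^[n] (ccH d B) = fun S => (1 - ∑ k ∈ B, p k) ^ n * ccH d B S := by
  induction n with
  | zero => simp
  | succ n ih =>
    rw [Function.iterate_succ_apply', ih]
    funext S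
    simp only [ccA]
    have h : ∀ k, p k * ((1 - ∑ k ∈ B, p k) ^ n * ccH d B (insert k S)) =
        (1 - ∑ k ∈ B, p k) ^ n * ccH d B S * (p k - if k ∈ B then p k else 0) := by
      intro k
      unfold ccH
      by_cases h1 : k ∈ B <;> by_cases h2 : Disjoint B S <;> simp [Finset.disjoint_insert_right, h1, h2, mul_comm]
    simp only [h]
    rw [← Finset.mul_sum, Finset.sum_sub_distrib, hp, Finset.sum_ite_mem, Finset.univ_inter]
    ring

lemma ccA_const (hp : ∑ k, p k = 1) (n : ℕ) (c : ℝ) (S : Finset (Fin d)) :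
    ((ccA d p)^[n] (fun _ => c)) S = c := by
  have h := ccA_H d p hp n ∅
  have h1 : ccH d ∅ = fun _ => 1 := by funext S; simp [ccH]
  have h2 := ccA_smul d p n c (fun _ => 1)
  rw [← h1, h] at h2
  simp [ccH] at h2
  rw [h2]

/-- Probability that all coupons are collected by time `n`. -/
noncomputable def ccFull (n : ℕ) : ℝ :=
  ((ccA d p)^[n] (fun S => if S = Finset.univ then 1 else 0)) ∅

lemma ccFull_nonneg (hp0 : ∀ k, 0 ≤ p k) (hp : ∑ k, p k = 1) (n : ℕ) : 0 ≤ ccFull d p n := by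
  rw [← ccA_const d p hp n 0 ∅]
  refine ccA_mono d p hp0 n (fun S => ?_) ∅
  split_ifs <;> norm_num

lemma ccFull_le_one (hp0 : ∀ k, 0 ≤ p k) (hp : ∑ k, p k = 1) (n : ℕ) : ccFull d p n ≤ 1 := by
  rw [← ccA_const d p hp n 1 ∅]
  refine ccA_mono d p hp0 n (fun S => ?_) ∅
  split_ifs <;> norm_num

lemma ccFull_ge (hp0 : ∀ k, 0 ≤ p k) (hp : ∑ k, p k = 1) (n : ℕ) :
    1 - ccFull d p n ≤ ∑ k, (1 - p k) ^ n := by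
  have h := ccA_mono d p hp0 n (F := fun _ => 1)
    (G := fun S => (if S = Finset.univ then 1 else 0) + ∑ k, ccH d {k} S) (fun S => by
      split_ifs with hS
      · have : 0 ≤ ∑ k, ccH d {k} S := Finset.sum_nonneg fun k _ => by
          unfold ccH; split_ifs <;> norm_num
        linarith
      · obtain ⟨k, hk⟩ : ∃ k, k ∉ S := by
          by_contra hcon
          push Not at hcon
          exact hS (Finset.eq_univ_iff_forall.mpr hcon)
        have h1 : ccH d {k} S ≤ ∑ k, ccH d {k} S :=
          Finset.single_le_sum (f := fun k => ccH d {k} S) (fun k _ => by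
            unfold ccH; split_ifs <;> norm_num) (Finset.mem_univ k)
        have h2 : ccH d {k} S = 1 := by simp [ccH, hk]
        linarith) ∅
  rw [ccA_const d p hp, ccA_add, ccA_sum] at h
  simp only [ccA_H d p hp] at h
  simp [ccH] at h
  unfold ccFull
  linarith

lemma ccFull_le (hp0 : ∀ k, 0 ≤ p k) (hp : ∑ k, p k = 1) (n : ℕ) (K : Finset (Fin d))
    (M : ℝ) (hM : M = ∑ k ∈ K, (1 - p k) ^ n) (hMpos : 0 < M) :
    ccFull d p n ≤ 1 / M := by
  have h := ccA_mono d p hp0 n (F := fun S => if S = Finset.univ then 1 else 0)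
    (G := fun S => (1 / M ^ 2) * (∑ k ∈ K, ∑ l ∈ K, ccH d {k, l} S)
      + ((- 2 / M) * (∑ k ∈ K, ccH d {k} S) + 1)) (fun S => by
      have e : ∑ k ∈ K, ∑ l ∈ K, ccH d {k, l} S = (∑ k ∈ K, ccH d {k} S) ^ 2 := by
        rw [sq, Finset.sum_mul_sum]
        refine Finset.sum_congr rfl fun k _ => Finset.sum_congr rfl fun l _ => ?_
        unfold ccH
        by_cases h1 : k ∈ S <;> by_cases h2 : l ∈ S <;> simp [h1, h2]
      simp only [e]
      have e2 : (1 / M ^ 2) * (∑ k ∈ K, ccH d {k} S) ^ 2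
          + ((- 2 / M) * (∑ k ∈ K, ccH d {k} S) + 1) = ((∑ k ∈ K, ccH d {k} S) / M - 1) ^ 2 := by
        field_simp; ring
      rw [e2]
      split_ifs with hS
      · have : ∑ k ∈ K, ccH d {k} S = 0 := by
          refine Finset.sum_eq_zero fun k _ => ?_
          simp [ccH, hS]
        rw [this]; norm_num
      · positivity) ∅
  rw [ccA_add, ccA_add, ccA_smul, ccA_smul, ccA_sum, ccA_sum] at h
  simp only [ccA_sum, ccA_H d p hp, ccA_const d p hp] at h
  simp only [ccH, Finset.disjoint_empty_right, if_true, mul_one, Finset.sum_singleton,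
    ← hM] at h
  have h2 : ∑ k ∈ K, ∑ l ∈ K, (1 - ∑ x ∈ ({k, l} : Finset (Fin d)), p x) ^ n ≤ M ^ 2 + M := by
    have h3 : M ^ 2 + M = ∑ k ∈ K, ∑ l ∈ K,
        ((1 - p k) ^ n * (1 - p l) ^ n + if k = l then (1 - p k) ^ n else 0) := by
      simp only [Finset.sum_add_distrib]
      rw [sq]
      nth_rewrite 1 2 [hM]
      rw [Finset.sum_mul_sum]
      congr 1
      rw [hM]
      refine Finset.sum_congr rfl fun k hk => ?_
      simp [hk]
    rw [h3]
    have hp1 : ∀ k, p k ≤ 1 := fun k => by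
      rw [← hp]; exact Finset.single_le_sum (fun k _ => hp0 k) (Finset.mem_univ k)
    refine Finset.sum_le_sum fun k _ => Finset.sum_le_sum fun l _ => ?_
    by_cases hkl : k = l
    · subst hkl
      have := hp1 k
      have : 0 ≤ (1 - p k) ^ n * (1 - p k) ^ n := by
        apply mul_self_nonneg
      simpa using this
    · rw [if_neg hkl, Finset.sum_pair hkl, ← mul_pow, add_zero]
      have : ∑ x ∈ ({k, l} : Finset (Fin d)), p x ≤ ∑ x, p x :=
        Finset.sum_le_sum_of_subset_of_nonneg (Finset.subset_univ _) fun k _ _ => hp0 k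
      rw [Finset.sum_pair hkl, hp] at this
      refine pow_le_pow_left₀ (by linarith) ?_ n
      nlinarith [mul_nonneg (hp0 k) (hp0 l)]
  have h4 : (1 / M ^ 2) * ∑ k ∈ K, ∑ l ∈ K, (1 - ∑ x ∈ ({k, l} : Finset (Fin d)), p x) ^ n ≤
      (1 / M ^ 2) * (M ^ 2 + M) := mul_le_mul_of_nonneg_left h2 (by positivity)
  have h5 : (1 / M ^ 2) * (M ^ 2 + M) = 1 + 1 / M := by field_simp
  have h6 : - 2 / M * M = - 2 := by field_simp
  unfold ccFull
  rw [h6] at h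
  linarith

end ops

lemma cc_sep (d : ℕ) (p a : Fin d → ℝ) (hp0 : ∀ k, 0 ≤ p k) (hp : ∑ k, p k = 1)
    (ha : ∀ k, 0 < a k ∧ a k < 1) (n : ℕ) :
    sep ((fun i : Cube d => if i = 0 then (1 : ℝ) else 0) ᵥ* (cubeAntidual d p a) ^ n)
      (cubePi d a) = 1 - ccFull d p n := by
  have h0 : (fun i : Cube d => if i = 0 then (1 : ℝ) else 0) = ccNu d a ∅ := by
    funext i
    unfold ccNu
    simp only [Finset.notMem_empty, if_false]
    rw [Finset.prod_ite_zero]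
    simp [funext_iff]
  have hq : ∀ k v, 0 < ccQ (a k) v := by
    intro k v
    unfold ccQ
    split_ifs
    · exact (ha k).1
    · linarith [(ha k).2]
  have hpi : ∀ i, 0 < cubePi d a i := fun i => Finset.prod_pos fun k _ => hq k (i k)
  have hfull : ∀ i, ((ccA d p)^[n] (fun S => cubePi d a i * (if S = Finset.univ then 1 else 0))) ∅
      = cubePi d a i * ccFull d p n := by
    intro i; rw [ccA_smul]; rfl
  rw [h0]
  unfold sep
  apply le_antisymm
  · refine Finset.sup'_le _ _ fun i _ => ?_
    rw [cc_pow d p a hp]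
    have : ccFull d p n ≤ ((ccA d p)^[n] (fun S => ccNu d a S i)) ∅ / cubePi d a i := by
      rw [le_div_iff₀ (hpi i), mul_comm, ← hfull]
      refine ccA_mono d p hp0 n (fun S => ?_) ∅
      split_ifs with hS
      · subst hS
        simp [ccNu, cubePi, ccQ]
      · simp only [mul_zero]
        refine Finset.prod_nonneg fun j _ => ?_
        split_ifs
        · exact (hq _ _).le
        · norm_num
        · norm_num
    linarith
  · refine le_trans (le_of_eq ?_) (Finset.le_sup' _ (Finset.mem_univ (fun _ => 1 : Cube d)))
    rw [cc_pow d p a hp]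
    have : (fun S => ccNu d a S (fun _ => 1)) =
        (fun S => cubePi d a (fun _ => 1) * (if S = Finset.univ then 1 else 0)) := by
      funext S
      split_ifs with hS
      · subst hS
        simp [ccNu, cubePi, ccQ]
      · obtain ⟨k, hk⟩ : ∃ k, k ∉ S := by
          by_contra hcon
          push Not at hcon
          exact hS (Finset.eq_univ_iff_forall.mpr hcon)
        rw [mul_zero]
        exact Finset.prod_eq_zero (Finset.mem_univ k) (by simp [hk])
    rw [this, hfull, mul_div_cancel_left₀ _ (hpi _).ne']

lemma pc_nn_le (nn : ℕ → ℝ) (m : ℕ) (hnnmono : ∀ i, i < m → nn i < nn (i + 1))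
    (i j : ℕ) (hij : i ≤ j) (hj : j ≤ m) : nn i ≤ nn j := by
  induction j, hij using Nat.le_induction with
  | base => exact le_rfl
  | succ j hij ih => exact (ih (by omega)).trans (hnnmono j (by omega)).le

lemma pc_lam_ge (lam : ℕ → ℝ) (m : ℕ)
    (hlammono : ∀ i, 1 ≤ i → i + 1 ≤ m → lam i < lam (i + 1))
    (j : ℕ) (hij : 1 ≤ j) (hj : j ≤ m) : lam 1 ≤ lam j := by
  induction j, hij using Nat.le_induction with
  | base => exact le_rfl
  | succ j hij ih => exact (ih (by omega)).trans (hlammono j (by omega) (by omega)).le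

lemma pc_eq
    (m : ℕ)
    (lam nn : ℕ → ℝ)
    : pieceF m lam nn = fun y => ∑ i ∈ Finset.range m,
    (Set.Ioc (nn i) (nn (i + 1))).indicator (fun _ => lam (i + 1)) y := by
  funext y
  unfold pieceF
  refine Finset.sum_congr rfl fun i _ => ?_
  simp [Set.indicator, Set.mem_Ioc]

lemma pc_int
    (m : ℕ)
    (lam nn : ℕ → ℝ)
    : Integrable (pieceF m lam nn) := by
  rw [pc_eq]
  refine integrable_finsetSum _ fun i _ => ?_
  rw [integrable_indicator_iff measurableSet_Ioc]
  exact integrableOn_const (by simp)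


lemma pc_ge
    (m : ℕ)
    (hm : 1 ≤ m)
    (lam nn : ℕ → ℝ)
    (hnn0 : nn 0 = 0)
    (hnnm : nn m = 1)
    (hnnmono : ∀ i, i < m → nn i < nn (i + 1))
    (hlam1 : 0 < lam 1)
    (hlammono : ∀ i, 1 ≤ i → i + 1 ≤ m → lam i < lam (i + 1))
    (y : ℝ) (h0 : 0 < y) (h1 : y ≤ 1) : lam 1 ≤ pieceF m lam nn y := by
  have hex : ∃ i, y ≤ nn i := ⟨m, by rw [hnnm]; exact h1⟩
  set j := Nat.find hex with hj
  have hjy : y ≤ nn j := Nat.find_spec hex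
  have hjm : j ≤ m := Nat.find_min' hex (by rw [hnnm]; exact h1)
  have hj0 : j ≠ 0 := by
    intro h; rw [h, hnn0] at hjy; linarith
  obtain ⟨i, hi⟩ := Nat.exists_eq_succ_of_ne_zero hj0
  have hiy : nn i < y := by
    have := Nat.find_min hex (m := i) (by omega)
    exact not_le.mp this
  rw [Nat.succ_eq_add_one] at hi
  rw [hi] at hjy
  have hl := pc_lam_ge lam m hlammono (i + 1) (by omega) (by omega)
  refine hl.trans ?_
  unfold pieceF
  have := Finset.single_le_sum
    (f := fun i => if nn i < y ∧ y ≤ nn (i + 1) then lam (i + 1) else 0)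
    (s := Finset.range m) (fun k hk => by
      have := pc_lam_ge lam m hlammono (k + 1) (by omega)
        (by have := Finset.mem_range.mp hk; omega)
      split_ifs
      · linarith
      · exact le_rfl) (Finset.mem_range.mpr (show i < m by omega))
  simpa [hiy, hjy] using this

lemma pc_first
    (m : ℕ)
    (hm : 1 ≤ m)
    (lam nn : ℕ → ℝ)
    (hnn0 : nn 0 = 0)
    (hnnmono : ∀ i, i < m → nn i < nn (i + 1))
    (y : ℝ) (h0 : 0 < y) (h1 : y ≤ nn 1) : pieceF m lam nn y = lam 1 := by
  unfold pieceF
  rw [Finset.sum_eq_single 0]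
  · simp [hnn0, h0, h1]
  · intro i hi hi0
    have := pc_nn_le nn m hnnmono 1 i (by omega) (by have := Finset.mem_range.mp hi; omega)
    rw [if_neg]
    rintro ⟨h, _⟩
    linarith
  · intro h; exact absurd (Finset.mem_range.mpr (by omega)) h

lemma pInt_ge
    (m : ℕ)
    (hm : 1 ≤ m)
    (lam nn : ℕ → ℝ)
    (hnn0 : nn 0 = 0)
    (hnnm : nn m = 1)
    (hnnmono : ∀ i, i < m → nn i < nn (i + 1))
    (hlam1 : 0 < lam 1)
    (hlammono : ∀ i, 1 ≤ i → i + 1 ≤ m → lam i < lam (i + 1))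
    (d : ℕ) (hd : 1 ≤ d) (k : Fin d) : lam 1 / d ≤ pInt m lam nn d k := by
  have hd' : (0 : ℝ) < d := by exact_mod_cast hd
  have hk : ((k : ℝ) + 1) ≤ d := by exact_mod_cast k.2
  have h1 : ∫ y in Set.Ioc ((k : ℝ) / d) (((k : ℝ) + 1) / d), lam 1 = lam 1 / d := by
    have : (k : ℝ) / d ≤ (k + 1) / d := by gcongr; linarith
    simp [measureReal_def, Real.volume_Ioc]
    rw [← sub_div, add_sub_cancel_left]
    rw [ENNReal.toReal_ofReal (by positivity)]
    field_simp
  rw [← h1]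
  refine setIntegral_mono_on (integrableOn_const (by simp)) (pc_int m lam nn).integrableOn
    measurableSet_Ioc fun y hy => ?_
  refine pc_ge m hm lam nn hnn0 hnnm hnnmono hlam1 hlammono y ?_ ?_
  · exact lt_of_le_of_lt (by positivity) hy.1
  · exact hy.2.trans ((div_le_one hd').mpr hk)

lemma pInt_first
    (m : ℕ)
    (hm : 1 ≤ m)
    (lam nn : ℕ → ℝ)
    (hnn0 : nn 0 = 0)
    (hnnmono : ∀ i, i < m → nn i < nn (i + 1))
    (d : ℕ) (hd : 1 ≤ d) (k : Fin d) (hk : ((k : ℝ) + 1) / d ≤ nn 1) :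
    pInt m lam nn d k = lam 1 / d := by
  have hd' : (0 : ℝ) < d := by exact_mod_cast hd
  have h1 : ∫ y in Set.Ioc ((k : ℝ) / d) (((k : ℝ) + 1) / d), lam 1 = lam 1 / d := by
    have : (k : ℝ) / d ≤ (k + 1) / d := by gcongr; linarith
    simp [measureReal_def, Real.volume_Ioc]
    rw [← sub_div, add_sub_cancel_left]
    rw [ENNReal.toReal_ofReal (by positivity)]
    field_simp
  rw [← h1]
  refine setIntegral_congr_fun measurableSet_Ioc fun y hy => ?_
  refine pc_first m hm lam nn hnn0 hnnmono y ?_ (hy.2.trans hk)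
  exact lt_of_le_of_lt (by positivity) hy.1

lemma pInt_sum
    (m : ℕ)
    (lam nn : ℕ → ℝ)
    (hnn0 : nn 0 = 0)
    (hnnm : nn m = 1)
    (hnnmono : ∀ i, i < m → nn i < nn (i + 1))
    (hdens : ∑ i ∈ Finset.range m, lam (i + 1) * (nn (i + 1) - nn i) = 1)
    (d : ℕ) (hd : 1 ≤ d) : ∑ k, pInt m lam nn d k = 1 := by
  have hd' : (0 : ℝ) < d := by exact_mod_cast hd
  have h1 : ∑ k, pInt m lam nn d k = ∑ k ∈ Finset.range d,
      ∫ y in ((k : ℝ) / d)..(((k + 1 : ℕ) : ℝ) / d), pieceF m lam nn y := by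
    rw [Finset.sum_range]
    refine Finset.sum_congr rfl fun k _ => ?_
    rw [intervalIntegral.integral_of_le (by push_cast; gcongr; linarith)]
    simp [pInt]
  rw [h1, intervalIntegral.sum_integral_adjacent_intervals (a := fun k : ℕ => (k : ℝ) / d)
    (fun k _ => (pc_int m lam nn).intervalIntegrable)]
  simp only [Nat.cast_zero, zero_div, div_self hd'.ne']
  rw [intervalIntegral.integral_of_le zero_le_one, pc_eq, integral_finsetSum]
  · refine Eq.trans ?_ hdens
    refine Finset.sum_congr rfl fun i hi => ?_
    have hi' := Finset.mem_range.mp hi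
    have e1 := pc_nn_le nn m hnnmono 0 i (by omega) (by omega)
    have e2 := pc_nn_le nn m hnnmono (i + 1) m (by omega) (by omega)
    have e3 := hnnmono i hi'
    rw [hnn0] at e1
    rw [hnnm] at e2
    rw [setIntegral_indicator measurableSet_Ioc, Set.inter_eq_self_of_subset_right
      (Set.Ioc_subset_Ioc e1 e2)]
    simp [measureReal_def, Real.volume_Ioc]
    rw [ENNReal.toReal_ofReal (by linarith)]
    ring
  · intro i _
    refine Integrable.integrableOn ?_
    rw [integrable_indicator_iff measurableSet_Ioc]
    exact integrableOn_const (by simp)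

lemma cc_exp_bound (q L : ℝ) (n : ℕ) (hq : 0 < q) (hq2 : q ≤ 1 / 2) (hL : 0 ≤ L)
    (hn : n * q ≤ L) (hLq : 2 * L * q ≤ 1) : Real.exp (-L - 1) ≤ (1 - q) ^ n := by
  have h1 : Real.exp (-(q / (1 - q))) ≤ 1 - q := by
    have := Real.add_one_le_exp (q / (1 - q))
    have e : q / (1 - q) + 1 = (1 - q)⁻¹ := by
      have : 1 - q ≠ 0 := by linarith
      field_simp; ring
    rw [e] at this
    rw [Real.exp_neg]
    exact inv_le_of_inv_le₀ (by linarith) this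
  have h2 : Real.exp (-(q / (1 - q))) ^ n ≤ (1 - q) ^ n :=
    pow_le_pow_left₀ (Real.exp_pos _).le h1 n
  refine le_trans ?_ h2
  rw [← Real.exp_nat_mul]
  apply Real.exp_le_exp.mpr
  have e : (n : ℝ) * -(q / (1 - q)) = -(n * q / (1 - q)) := by ring
  rw [e]
  have h3 : n * q / (1 - q) ≤ L + 1 := by
    rw [div_le_iff₀ (by linarith)]
    nlinarith
  linarith

/-- Separation cutoff at time `(d/λ₁)(log d − log n₁)` with window `d/λ₁` for
coupon collecting driven by a piecewise constant density. -/
theorem stmt13 (m : ℕ) (hm : 1 ≤ m) (lam nn : ℕ → ℝ)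
    (hnn0 : nn 0 = 0) (hnnm : nn m = 1)
    (hnnmono : ∀ i, i < m → nn i < nn (i + 1))
    (hlam1 : 0 < lam 1)
    (hlammono : ∀ i, 1 ≤ i → i + 1 ≤ m → lam i < lam (i + 1))
    (hdens : ∑ i ∈ Finset.range m, lam (i + 1) * (nn (i + 1) - nn i) = 1)
    (a : (d : ℕ) → Fin d → ℝ) (ha : ∀ d k, 0 < a d k ∧ a d k < 1) :
    Tendsto (fun c : ℝ =>
        limsup (fun d : ℕ => sepPC m lam nn a d
          ⌈((d : ℝ) / lam 1) * (Real.log d - Real.log (nn 1)) + c * ((d : ℝ) / lam 1)⌉₊)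
          atTop)
      atTop (nhds 0) ∧
    Tendsto (fun c : ℝ =>
        liminf (fun d : ℕ => sepPC m lam nn a d
          ⌊((d : ℝ) / lam 1) * (Real.log d - Real.log (nn 1)) - c * ((d : ℝ) / lam 1)⌋₊)
          atTop)
      atTop (nhds 1) := by
  have hn1 : 0 < nn 1 := by have := hnnmono 0 (by omega); rwa [hnn0] at this
  have hn1' : nn 1 ≤ 1 := by rw [← hnnm]; exact pc_nn_le nn m hnnmono 1 m hm le_rfl
  have hge : ∀ d, 1 ≤ d → ∀ k, lam 1 / d ≤ pInt m lam nn d k := fun d hd k =>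
    pInt_ge m hm lam nn hnn0 hnnm hnnmono hlam1 hlammono d hd k
  have hp0 : ∀ d, 1 ≤ d → ∀ k, 0 ≤ pInt m lam nn d k := fun d hd k =>
    le_trans (by positivity) (hge d hd k)
  have hps : ∀ d, 1 ≤ d → ∑ k, pInt m lam nn d k = 1 := fun d hd =>
    pInt_sum m lam nn hnn0 hnnm hnnmono hdens d hd
  have hsep : ∀ d, 1 ≤ d → ∀ n, sepPC m lam nn a d n = 1 - ccFull d (pInt m lam nn d) n :=
    fun d hd n => cc_sep d _ _ (hp0 d hd) (hps d hd) (ha d) n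
  have hs0 : ∀ d, 1 ≤ d → ∀ n, 0 ≤ sepPC m lam nn a d n := fun d hd n => by
    rw [hsep d hd]; linarith [ccFull_le_one d _ (hp0 d hd) (hps d hd) n]
  have hs1 : ∀ d, 1 ≤ d → ∀ n, sepPC m lam nn a d n ≤ 1 := fun d hd n => by
    rw [hsep d hd]; linarith [ccFull_nonneg d _ (hp0 d hd) (hps d hd) n]
  have hev0 : ∀ t : ℕ → ℕ, ∀ᶠ d in atTop, 0 ≤ sepPC m lam nn a d (t d) := fun t =>
    (eventually_ge_atTop 1).mono fun d hd => hs0 d hd _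
  have hev1 : ∀ t : ℕ → ℕ, ∀ᶠ d in atTop, sepPC m lam nn a d (t d) ≤ 1 := fun t =>
    (eventually_ge_atTop 1).mono fun d hd => hs1 d hd _
  have hexp : Tendsto (fun c : ℝ => Real.exp (-c)) atTop (nhds 0) :=
    Real.tendsto_exp_neg_atTop_nhds_zero
  constructor
  · have hlim : Tendsto (fun c : ℝ => nn 1 * Real.exp (-c)) atTop (nhds 0) := by
      simpa using hexp.const_mul (nn 1)
    refine tendsto_of_tendsto_of_tendsto_of_le_of_le tendsto_const_nhds hlim (fun c => ?_)
      (fun c => ?_)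
    · exact le_limsup_of_frequently_le (hev0 (fun d => _)).frequently
        ⟨1, eventually_map.mpr (hev1 (fun d => _))⟩
    · refine limsup_le_of_le (IsCoboundedUnder.of_frequently_ge (a := 0)
        (hev0 (fun d => _)).frequently) ?_
      filter_upwards [eventually_ge_atTop 1] with d hd
      have hd' : (0 : ℝ) < d := by exact_mod_cast hd
      rw [hsep d hd]
      set n := ⌈((d : ℝ) / lam 1) * (Real.log d - Real.log (nn 1)) + c * ((d : ℝ) / lam 1)⌉₊
        with hn
      refine (ccFull_ge d _ (hp0 d hd) (hps d hd) n).trans ?_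
      have hn' : ((d : ℝ) / lam 1) * (Real.log d - Real.log (nn 1)) + c * ((d : ℝ) / lam 1) ≤ n :=
        Nat.le_ceil _
      have hnl : Real.log d - Real.log (nn 1) + c ≤ n * (lam 1 / d) := by
        have := mul_le_mul_of_nonneg_right hn' (show 0 ≤ lam 1 / d by positivity)
        refine le_trans (le_of_eq ?_) this
        field_simp
      have hterm : ∀ k, (1 - pInt m lam nn d k) ^ n ≤ nn 1 * Real.exp (-c) / d := by
        intro k
        have h1 : pInt m lam nn d k ≤ 1 := by
          rw [← hps d hd]
          exact Finset.single_le_sum (fun k _ => hp0 d hd k) (Finset.mem_univ k)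
        have h2 : 1 - pInt m lam nn d k ≤ Real.exp (-(lam 1 / d)) := by
          have := Real.add_one_le_exp (-(lam 1 / d))
          have := hge d hd k
          linarith
        calc (1 - pInt m lam nn d k) ^ n ≤ Real.exp (-(lam 1 / d)) ^ n :=
              pow_le_pow_left₀ (by linarith) h2 n
          _ = Real.exp (n * -(lam 1 / d)) := (Real.exp_nat_mul _ _).symm
          _ ≤ Real.exp (Real.log (nn 1) + -c - Real.log d) :=
              Real.exp_le_exp.mpr (by linarith)
          _ = _ := by rw [Real.exp_sub, Real.exp_add, Real.exp_log hn1, Real.exp_log hd']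
      refine (Finset.sum_le_sum fun k _ => hterm k).trans (le_of_eq ?_)
      simp
      field_simp
  · set C : ℝ := 2 * Real.exp 1 / nn 1 ^ 2 with hC
    have hlim : Tendsto (fun c : ℝ => 1 - C * Real.exp (-c)) atTop (nhds 1) := by
      simpa using (hexp.const_mul C).const_sub 1
    refine tendsto_of_tendsto_of_tendsto_of_le_of_le hlim tendsto_const_nhds (fun c => ?_)
      (fun c => ?_)
    · refine le_liminf_of_le (IsCoboundedUnder.of_frequently_le (a := 1)
        (hev1 (fun d => _)).frequently) ?_
      have hcast : Tendsto (fun d : ℕ => (d : ℝ)) atTop atTop := tendsto_natCast_atTop_atTop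
      have hlog : Tendsto (fun d : ℕ => Real.log d) atTop atTop :=
        Real.tendsto_log_atTop.comp hcast
      have hlogd : Tendsto (fun d : ℕ => Real.log d / d) atTop (nhds 0) :=
        (Real.isLittleO_log_id_atTop.tendsto_div_nhds_zero).comp hcast
      have hinv : Tendsto (fun d : ℕ => ((d : ℝ))⁻¹) atTop (nhds 0) :=
        tendsto_inv_atTop_zero.comp hcast
      have hbig : Tendsto (fun d : ℕ => 2 * lam 1 * (Real.log d / d) +
          (2 * (-Real.log (nn 1) - c) * lam 1) * ((d : ℝ))⁻¹) atTop (nhds 0) := by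
        simpa using (hlogd.const_mul (2 * lam 1)).add
          (hinv.const_mul (2 * (-Real.log (nn 1) - c) * lam 1))
      filter_upwards [eventually_ge_atTop 1, hlog.eventually_ge_atTop (Real.log (nn 1) + c),
        hcast.eventually_ge_atTop (2 * lam 1), hcast.eventually_ge_atTop (2 / nn 1),
        hbig.eventually_le_const (show (0 : ℝ) < 1 by norm_num)] with d hd hL hq hN hLq
      have hd' : (0 : ℝ) < d := by exact_mod_cast hd
      rw [hsep d hd]
      set n := ⌊((d : ℝ) / lam 1) * (Real.log d - Real.log (nn 1)) - c * ((d : ℝ) / lam 1)⌋₊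
        with hn
      set L := Real.log d - Real.log (nn 1) - c with hLdef
      have hL0 : 0 ≤ L := by linarith
      have hn' : (n : ℝ) ≤ (d : ℝ) / lam 1 * L := by
        refine (Nat.floor_le ?_).trans (le_of_eq ?_)
        · have : 0 ≤ (d : ℝ) / lam 1 * L := by positivity
          refine le_trans this (le_of_eq ?_)
          rw [hLdef]; ring
        · rw [hLdef]; ring
      have hpow : Real.exp (-L - 1) ≤ (1 - lam 1 / d) ^ n := by
        refine cc_exp_bound _ L n (by positivity) ?_ hL0 ?_ ?_
        · rw [div_le_iff₀ hd']; linarith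
        · have := mul_le_mul_of_nonneg_right hn' (show 0 ≤ lam 1 / d by positivity)
          refine this.trans (le_of_eq ?_)
          field_simp
        · refine le_trans (le_of_eq ?_) hLq
          rw [hLdef]; field_simp; ring
      have hNd : ⌊nn 1 * d⌋₊ ≤ d := by
        apply Nat.floor_le_of_le
        nlinarith
      set K : Finset (Fin d) := Finset.univ.map (Fin.castLEEmb hNd) with hK
      have hKp : ∀ k ∈ K, pInt m lam nn d k = lam 1 / d := by
        intro k hk
        refine pInt_first m hm lam nn hnn0 hnnmono d hd k ?_
        rw [hK, Finset.mem_map] at hk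
        obtain ⟨j, _, rfl⟩ := hk
        rw [div_le_iff₀ hd']
        have h1 : ((j : ℕ) + 1 : ℝ) ≤ (⌊nn 1 * d⌋₊ : ℝ) := by exact_mod_cast j.2
        exact h1.trans (Nat.floor_le (by positivity))
      have hM : ∑ k ∈ K, (1 - pInt m lam nn d k) ^ n = ⌊nn 1 * d⌋₊ * (1 - lam 1 / d) ^ n := by
        rw [Finset.sum_congr rfl (fun k hk => by rw [hKp k hk])]
        simp [hK]
      have hfl : nn 1 * d / 2 ≤ (⌊nn 1 * d⌋₊ : ℝ) := by
        have h1 := (Nat.lt_floor_add_one (nn 1 * d)).le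
        have h2 : 2 ≤ nn 1 * d := by
          rw [div_le_iff₀ hn1] at hN; linarith
        linarith
      have hexpL : Real.exp (-L - 1) = nn 1 * Real.exp c / (d * Real.exp 1) := by
        have : -L - 1 = Real.log (nn 1) + c - (Real.log d + 1) := by rw [hLdef]; ring
        rw [this, Real.exp_sub, Real.exp_add, Real.exp_add, Real.exp_log hn1, Real.exp_log hd']
      have hMge : nn 1 ^ 2 * Real.exp c / (2 * Real.exp 1) ≤
          ⌊nn 1 * d⌋₊ * (1 - lam 1 / d) ^ n := by
        calc nn 1 ^ 2 * Real.exp c / (2 * Real.exp 1) = nn 1 * d / 2 * Real.exp (-L - 1) := by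
              rw [hexpL]; field_simp
          _ ≤ _ := mul_le_mul hfl hpow (Real.exp_pos _).le (by positivity)
      have hpos : 0 < nn 1 ^ 2 * Real.exp c / (2 * Real.exp 1) := by positivity
      have := ccFull_le d _ (hp0 d hd) (hps d hd) n K _ hM.symm (lt_of_lt_of_le hpos hMge)
      have h2 := one_div_le_one_div_of_le hpos hMge
      have h3 : 1 / (nn 1 ^ 2 * Real.exp c / (2 * Real.exp 1)) = C * Real.exp (-c) := by
        rw [hC, Real.exp_neg]; field_simp
      linarith
    · exact liminf_le_of_frequently_le (hev1 (fun d => _)).frequently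
        ⟨0, eventually_map.mpr (hev0 (fun d => _))⟩
end

section
/- Fix an integer N ≥ 2. For each d ≥ 1 let P_{(d)} be the antidual matrix on E_{(d)} = {0,1,…,N}^d with p_k = 1/d and N_1 = … = N_d = N, namely: P_{(d)}(i, i+s_k) = ((i_k+1)/(i_k+2))·(1/d) when i_k < N; P_{(d)}(i, i−m·s_k) = (1/d)/((i_k+1)(i_k+2)) when i_k < N and 1 ≤ m ≤ i_k; P_{(d)}(i, i−m·s_k) = (1/d)/(N+1) when i_k = N and 1 ≤ m ≤ i_k; P_{(d)}(i,i) = 1 − Σ_{j: i_j<N} (1 − 1/((i_j+1)(i_j+2)))·(1/d) − Σ_{j: i_j=N} (N/(N+1))·(1/d); other entries 0. Let π_{(d)} be the uniform distribution on E_{(d)} and sep_d(n) := sep(δ₀ P_{(d)}ⁿ, π_{(d)}). Then the sequence exhibits a separation cutoff at time t_d = d·log d + (N−1)·d·log log d with window size d: lim_{c→+∞} limsup_{d→∞} sep_d(⌈t_d + c·d⌉) = 0 and lim_{c→+∞} liminf_{d→∞} sep_d(⌊t_d − c·d⌋₊) = 1, where log is the natural logarithm, ⌈x⌉ is the least integer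 ≥ x, and ⌊x⌋₊ := max(⌊x⌋, 0). -/
open Matrix Finset Filter
open scoped Classical

/-- State space of the generalized coupon collector problem:
`E = ∏_j {0,1,…,N_j}`. -/
abbrev CCState (d : ℕ) (N : Fin d → ℕ) : Type := ∀ j : Fin d, Fin (N j + 1)

/-- The antidual chain of Theorem 3 (general `N_j`, uniform stationary law). -/
noncomputable def antidualCC (d : ℕ) (N : Fin d → ℕ) (p : Fin d → ℝ) :
    Matrix (CCState d N) (CCState d N) ℝ := fun i i' =>
  (∑ k : Fin d, if (i' k : ℕ) = (i k : ℕ) + 1 ∧ (∀ j, j ≠ k → i' j = i j)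
      then (((i k : ℕ) : ℝ) + 1) / (((i k : ℕ) : ℝ) + 2) * p k else 0) +
  (∑ k : Fin d, if (i' k : ℕ) < (i k : ℕ) ∧ (∀ j, j ≠ k → i' j = i j)
      then (if (i k : ℕ) < N k
            then p k / ((((i k : ℕ) : ℝ) + 1) * (((i k : ℕ) : ℝ) + 2))
            else p k / ((N k : ℝ) + 1))
      else 0) +
  (if i' = i
      then 1 - ∑ j : Fin d, (if (i j : ℕ) < N j
            then (1 - 1 / ((((i j : ℕ) : ℝ) + 1) * (((i j : ℕ) : ℝ) + 2))) * p j
            else ((N j : ℝ) / ((N j : ℝ) + 1)) * p j)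
      else 0)

/-- Separation distance at time `n` of the antidual chain on `{0,…,N}^d`
with `p_k = 1/d`, started at `(0,…,0)`, from the uniform distribution. -/
noncomputable def sepN (N : ℕ) (d : ℕ) (n : ℕ) : ℝ :=
  sep ((fun i : CCState d (fun _ => N) => if i = 0 then (1 : ℝ) else 0) ᵥ*
        (antidualCC d (fun _ => N) (fun _ => 1 / (d : ℝ))) ^ n)
      (fun _ => 1 / ((N : ℝ) + 1) ^ d)


noncomputable def dcB (p : ℝ) (n j : ℕ) : ℝ := (n.choose j : ℝ) * p ^ j * (1 - p) ^ (n - j)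

noncomputable def dcG (p : ℝ) (n a : ℕ) : ℝ := ∑ j ∈ Finset.range a, dcB p n j

lemma dcB_succ (p : ℝ) (n j : ℕ) :
    dcB p (n + 1) (j + 1) = p * dcB p n j + (1 - p) * dcB p n (j + 1) := by
  unfold dcB
  rw [Nat.choose_succ_succ]
  push_cast
  rcases lt_or_ge j n with h | h
  · have e1 : n + 1 - (j + 1) = (n - (j + 1)) + 1 := by omega
    have e2 : n - j = (n - (j + 1)) + 1 := by omega
    simp only [e2, Nat.succ_eq_add_one]
    ring
  · have : n.choose (j + 1) = 0 := Nat.choose_eq_zero_of_lt (by omega)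
    have e1 : n + 1 - (j + 1) = n - j := by omega
    simp only [this, Nat.succ_eq_add_one]
    push_cast
    ring

lemma dcB_succ_zero (p : ℝ) (n : ℕ) : dcB p (n + 1) 0 = (1 - p) * dcB p n 0 := by
  simp [dcB, pow_succ]; ring

lemma dcG_succ (p : ℝ) (n a : ℕ) :
    dcG p (n + 1) (a + 1) = p * dcG p n a + (1 - p) * dcG p n (a + 1) := by
  unfold dcG
  rw [Finset.sum_range_succ' (fun j => dcB p (n + 1) j), Finset.sum_range_succ' (fun j => dcB p n j) a]
  simp only [dcB_succ, dcB_succ_zero, Finset.sum_add_distrib, ← Finset.mul_sum]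
  ring

lemma dcG_zero_right (p : ℝ) (n : ℕ) : dcG p n 0 = 0 := by simp [dcG]

lemma dcG_zero_left (p : ℝ) (a : ℕ) : dcG p 0 (a + 1) = 1 := by
  unfold dcG
  rw [Finset.sum_range_succ']
  simp [dcB]

lemma dcB_nonneg {p : ℝ} (hp : 0 ≤ p) (hp1 : p ≤ 1) (n j : ℕ) : 0 ≤ dcB p n j := by
  unfold dcB
  have : 0 ≤ 1 - p := by linarith
  positivity

lemma dcG_nonneg {p : ℝ} (hp : 0 ≤ p) (hp1 : p ≤ 1) (n j : ℕ) : 0 ≤ dcG p n j :=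
  Finset.sum_nonneg fun _ _ => dcB_nonneg hp hp1 _ _

lemma dcG_mono {p : ℝ} (hp : 0 ≤ p) (hp1 : p ≤ 1) (n : ℕ) {a b : ℕ} (h : a ≤ b) :
    dcG p n a ≤ dcG p n b := by
  unfold dcG
  apply Finset.sum_le_sum_of_subset_of_nonneg
  · intro x hx; simp at *; omega
  · intros; exact dcB_nonneg hp hp1 _ _

lemma dcG_le_one {p : ℝ} (hp : 0 ≤ p) (hp1 : p ≤ 1) (n : ℕ) : ∀ a, dcG p n a ≤ 1 := by
  induction n with
  | zero =>
    intro a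
    cases a with
    | zero => simp [dcG]
    | succ a => rw [dcG_zero_left]
  | succ n ih =>
    intro a
    cases a with
    | zero => simp [dcG]
    | succ a =>
      rw [dcG_succ]
      nlinarith [ih a, ih (a + 1)]

lemma dcPhi_succ (p : ℝ) (N n m : ℕ) :
    dcG p (n + 1) (N - m) = p * dcG p n (N - (m + 1)) + (1 - p) * dcG p n (N - m) := by
  rcases lt_or_ge m N with h | h
  · have : N - m = (N - (m + 1)) + 1 := by omega
    rw [this, dcG_succ]
  · have h1 : N - m = 0 := by omega
    have h2 : N - (m + 1) = 0 := by omega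
    rw [h1, h2]; simp [dcG_zero_right]

/-- Averaging operator of the coupon collector. -/
noncomputable def dcA (d : ℕ) (f : (Fin d → ℕ) → ℝ) : (Fin d → ℕ) → ℝ := fun m =>
  (1 / (d : ℝ)) * ∑ k : Fin d, f (Function.update m k (m k + 1))

lemma dcA_mono {d : ℕ} {f g : (Fin d → ℕ) → ℝ} (h : ∀ m, f m ≤ g m) (n : ℕ) :
    ∀ m, (dcA d)^[n] f m ≤ (dcA d)^[n] g m := by
  induction n with
  | zero => simpa using h
  | succ n ih =>
    intro m
    rw [Function.iterate_succ_apply', Function.iterate_succ_apply']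
    unfold dcA
    gcongr
    exact ih _

lemma dcA_smul {d : ℕ} (c : ℝ) (f : (Fin d → ℕ) → ℝ) (n : ℕ) :
    ∀ m, (dcA d)^[n] (fun m => c * f m) m = c * (dcA d)^[n] f m := by
  induction n with
  | zero => simp
  | succ n ih =>
    intro m
    rw [Function.iterate_succ_apply', Function.iterate_succ_apply']
    unfold dcA at *
    simp only [ih, ← Finset.mul_sum]
    ring

noncomputable def dcT (d N : ℕ) : (Fin d → ℕ) → ℝ := fun m => if ∀ k, N ≤ m k then 1 else 0

lemma dcT_nonneg (d N n : ℕ) : ∀ m, 0 ≤ (dcA d)^[n] (dcT d N) m := by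
  induction n with
  | zero => intro m; simp only [Function.iterate_zero, id, dcT]; split_ifs <;> norm_num
  | succ n ih =>
    intro m
    rw [Function.iterate_succ_apply']
    unfold dcA at *
    have := Finset.sum_nonneg (s := Finset.univ) fun k _ => ih (Function.update m k (m k + 1))
    positivity

lemma dc_prod_aux {ι : Type*} [DecidableEq ι] (s : Finset ι) (a b : ι → ℝ) (ha : ∀ i, 0 ≤ a i)
    (hb : ∀ i, 0 ≤ b i) :
    ∏ i ∈ s, a i + ∑ k ∈ s, b k * ∏ j ∈ s.erase k, a j ≤ ∏ i ∈ s, (a i + b i) := by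
  induction s using Finset.induction_on with
  | empty => simp
  | insert x s hx ih =>
    rw [Finset.prod_insert hx, Finset.sum_insert hx, Finset.prod_insert hx,
      Finset.erase_insert hx]
    have e : ∑ k ∈ s, b k * ∏ j ∈ (insert x s).erase k, a j
        = a x * ∑ k ∈ s, b k * ∏ j ∈ s.erase k, a j := by
      rw [Finset.mul_sum]
      refine Finset.sum_congr rfl fun k hk => ?_
      have hkx : x ≠ k := fun h => hx (h ▸ hk)
      rw [Finset.erase_insert_of_ne hkx, Finset.prod_insert (by simp [hx])]
      ring
    rw [e]
    have h0 : ∏ i ∈ s, a i ≤ ∏ i ∈ s, (a i + b i) :=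
      Finset.prod_le_prod (fun i _ => ha i) (fun i _ => by linarith [hb i])
    have h1 := mul_le_mul_of_nonneg_left ih (ha x)
    have h2 := mul_le_mul_of_nonneg_left h0 (hb x)
    linarith

lemma dc_upper {d : ℕ} (hd : 0 < d) (N n : ℕ) : ∀ m : Fin d → ℕ,
    (dcA d)^[n] (dcT d N) m ≤ ∏ k, (1 - dcG (1 / (d : ℝ)) n (N - m k)) := by
  have hdR : (0 : ℝ) < d := by exact_mod_cast hd
  have hd1 : (1 : ℝ) ≤ d := by exact_mod_cast hd
  have hp0 : 0 ≤ 1 / (d : ℝ) := by positivity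
  have hp1 : 1 / (d : ℝ) ≤ 1 := by rw [div_le_one hdR]; exact hd1
  induction n with
  | zero =>
    intro m
    simp only [Function.iterate_zero, id, dcT]
    split_ifs with h
    · have : ∀ k, N - m k = 0 := fun k => by have := h k; omega
      simp [this, dcG_zero_right]
    · exact Finset.prod_nonneg fun k _ => by linarith [dcG_le_one hp0 hp1 0 (N - m k)]
  | succ n ih =>
    intro m
    rw [Function.iterate_succ_apply']
    set p := 1 / (d : ℝ) with hp
    have hpd : (d : ℝ) * p = 1 := by rw [hp]; field_simp
    calc dcA d ((dcA d)^[n] (dcT d N)) m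
        ≤ dcA d (fun m => ∏ k, (1 - dcG p n (N - m k))) m := by
          unfold dcA; gcongr; exact ih _
      _ = ∏ k, (1 - dcG p n (N - m k)) + ∑ k, (p * (dcG p n (N - m k) - dcG p n (N - (m k + 1))))
            * ∏ j ∈ Finset.univ.erase k, (1 - dcG p n (N - m j)) := by
          unfold dcA
          have e : ∀ k, ∏ j, (1 - dcG p n (N - Function.update m k (m k + 1) j))
              = ∏ j, (1 - dcG p n (N - m j)) + (dcG p n (N - m k) - dcG p n (N - (m k + 1)))
                * ∏ j ∈ Finset.univ.erase k, (1 - dcG p n (N - m j)) := by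
            intro k
            rw [← Finset.mul_prod_erase _ _ (Finset.mem_univ k),
              ← Finset.mul_prod_erase _ (fun j => (1 - dcG p n (N - m j))) (Finset.mem_univ k)]
            have : ∏ j ∈ Finset.univ.erase k, (1 - dcG p n (N - Function.update m k (m k + 1) j))
                = ∏ j ∈ Finset.univ.erase k, (1 - dcG p n (N - m j)) := by
              refine Finset.prod_congr rfl fun j hj => ?_
              rw [Function.update_of_ne (Finset.ne_of_mem_erase hj)]
            rw [this, Function.update_self]
            ring
          simp only [e, Finset.sum_add_distrib, mul_add, Finset.mul_sum, mul_assoc]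
          simp only [Finset.sum_const, Finset.card_univ, Fintype.card_fin, nsmul_eq_mul, ← hp]
          rw [← mul_assoc, hpd, one_mul]
      _ ≤ ∏ k, ((1 - dcG p n (N - m k)) + p * (dcG p n (N - m k) - dcG p n (N - (m k + 1)))) := by
          apply dc_prod_aux
          · intro k; linarith [dcG_le_one hp0 hp1 n (N - m k)]
          · intro k
            have := dcG_mono hp0 hp1 n (show N - (m k + 1) ≤ N - m k by omega)
            exact mul_nonneg hp0 (by linarith)
      _ = _ := by
          refine Finset.prod_congr rfl fun k _ => ?_
          rw [dcPhi_succ]; ring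

lemma dc_lower {d : ℕ} (hd : 0 < d) (N n : ℕ) : ∀ m : Fin d → ℕ,
    1 - ∑ k, dcG (1 / (d : ℝ)) n (N - m k) ≤ (dcA d)^[n] (dcT d N) m := by
  have hdR : (0 : ℝ) < d := by exact_mod_cast hd
  have hd1 : (1 : ℝ) ≤ d := by exact_mod_cast hd
  have hp0 : 0 ≤ 1 / (d : ℝ) := by positivity
  have hp1 : 1 / (d : ℝ) ≤ 1 := by rw [div_le_one hdR]; exact hd1
  induction n with
  | zero =>
    intro m
    simp only [Function.iterate_zero, id, dcT]
    split_ifs with h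
    · linarith [Finset.sum_nonneg (s := Finset.univ) fun k _ => dcG_nonneg hp0 hp1 0 (N - m k)]
    · push Not at h
      obtain ⟨k, hk⟩ := h
      have h1 := Finset.single_le_sum (fun k _ => dcG_nonneg hp0 hp1 0 (N - m k)) (Finset.mem_univ k)
      have h2 : N - m k = (N - m k - 1) + 1 := by omega
      have h3 : dcG (1 / (d : ℝ)) 0 (N - m k) = 1 := by rw [h2, dcG_zero_left]
      rw [h3] at h1
      linarith
  | succ n ih =>
    intro m
    rw [Function.iterate_succ_apply']
    set p := 1 / (d : ℝ) with hp
    have hpd : (d : ℝ) * p = 1 := by rw [hp]; field_simp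
    calc _ = dcA d (fun m => 1 - ∑ k, dcG p n (N - m k)) m := by
          unfold dcA
          have e : ∀ k, ∑ j, dcG p n (N - Function.update m k (m k + 1) j)
              = ∑ j, dcG p n (N - m j) + (dcG p n (N - (m k + 1)) - dcG p n (N - m k)) := by
            intro k
            rw [← Finset.add_sum_erase _ _ (Finset.mem_univ k),
              ← Finset.add_sum_erase _ (fun j => (dcG p n (N - m j))) (Finset.mem_univ k)]
            have : ∑ j ∈ Finset.univ.erase k, (dcG p n (N - Function.update m k (m k + 1) j))
                = ∑ j ∈ Finset.univ.erase k, (dcG p n (N - m j)) := by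
              refine Finset.sum_congr rfl fun j hj => ?_
              rw [Function.update_of_ne (Finset.ne_of_mem_erase hj)]
            rw [this, Function.update_self]
            ring
          simp only [e, dcPhi_succ, Finset.sum_add_distrib, Finset.sum_sub_distrib, ← Finset.mul_sum]
          simp only [Finset.sum_const, Finset.card_univ, Fintype.card_fin, nsmul_eq_mul, ← hp]
          linear_combination (- 1 + ∑ j, dcG p n (N - m j)) * hpd
      _ ≤ _ := by
          unfold dcA; gcongr; exact ih _

noncomputable def dcu (N m : ℕ) (x : ℕ) : ℝ := if x ≤ m then 1 / ((min m N : ℕ) + 1 : ℝ) else 0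

noncomputable def dcQ (N x y : ℕ) : ℝ :=
  (if y = x + 1 then ((x : ℝ) + 1) / ((x : ℝ) + 2) else 0) +
  (if y ≤ x then (if x < N then 1 / (((x : ℝ) + 1) * ((x : ℝ) + 2)) else 1 / ((N : ℝ) + 1)) else 0)

lemma dc_sum1 (y M : ℕ) : ∑ x ∈ Finset.range M, (if y ≤ x then 1 / (((x : ℝ) + 1) * ((x : ℝ) + 2)) else 0)
    = if y ≤ M then 1 / ((y : ℝ) + 1) - 1 / ((M : ℝ) + 1) else 0 := by
  induction M with
  | zero =>
    split_ifs with h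
    · have : y = 0 := by omega
      simp [this]
    · simp
  | succ M ih =>
    rw [Finset.sum_range_succ, ih]
    rcases lt_trichotomy y (M + 1) with h | h | h
    · rw [if_pos (by omega), if_pos (by omega), if_pos (by omega)]
      push_cast
      field_simp
      ring
    · rw [if_neg (by omega), if_neg (by omega), if_pos (by omega)]
      subst h; simp
    · rw [if_neg (by omega), if_neg (by omega), if_neg (by omega)]; simp

lemma dc_sum2 (y M : ℕ) : ∑ x ∈ Finset.range M, (if y = x + 1 then ((x : ℝ) + 1) / ((x : ℝ) + 2) else 0)
    = if y ≤ M then (y : ℝ) / ((y : ℝ) + 1) else 0 := by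
  cases y with
  | zero => simp
  | succ z =>
    simp only [add_left_inj, Finset.sum_ite_eq, Finset.mem_range, Nat.succ_le_iff]
    push_cast
    congr 2
    ring

lemma dc_oneD (N m y : ℕ) (hy : y ≤ N) :
    ∑ x ∈ Finset.range (N + 1), dcu N m x * dcQ N x y = dcu N (m + 1) y := by
  rcases lt_or_ge m N with h | h
  · have e : ∀ x ∈ Finset.range (N + 1), dcu N m x * dcQ N x y = if x < m + 1 then
        (1 / ((m : ℝ) + 1)) * ((if y = x + 1 then ((x : ℝ) + 1) / ((x : ℝ) + 2) else 0) +
          (if y ≤ x then 1 / (((x : ℝ) + 1) * ((x : ℝ) + 2)) else 0)) else 0 := by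
      intro x hx
      unfold dcu dcQ
      rw [min_eq_left h.le]
      by_cases hxm : x ≤ m
      · rw [if_pos hxm, if_pos (show x < m + 1 by omega), if_pos (show x < N by omega)]
      · rw [if_neg hxm, if_neg (show ¬ x < m + 1 by omega), zero_mul]
    rw [Finset.sum_congr rfl e, ← Finset.sum_filter]
    have : (Finset.range (N + 1)).filter (fun x => x < m + 1) = Finset.range (m + 1) := by
      ext x; simp; omega
    rw [this, ← Finset.mul_sum, Finset.sum_add_distrib, dc_sum1, dc_sum2]
    unfold dcu
    rw [min_eq_left (by omega)]
    split_ifs with h1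
    · push_cast; field_simp; ring
    · simp
  · have e : ∀ x ∈ Finset.range (N + 1), dcu N m x * dcQ N x y =
        (1 / ((N : ℝ) + 1)) * dcQ N x y := by
      intro x hx
      have : x ≤ m := by simp at hx; omega
      simp [dcu, this, min_eq_right h]
    rw [Finset.sum_congr rfl e, ← Finset.mul_sum, Finset.sum_range_succ]
    have e2 : ∀ x ∈ Finset.range N, dcQ N x y =
        ((if y = x + 1 then ((x : ℝ) + 1) / ((x : ℝ) + 2) else 0) +
          (if y ≤ x then 1 / (((x : ℝ) + 1) * ((x : ℝ) + 2)) else 0)) := by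
      intro x hx
      simp at hx
      simp [dcQ, hx]
    rw [Finset.sum_congr rfl e2, Finset.sum_add_distrib, dc_sum1, dc_sum2]
    unfold dcu dcQ
    rw [min_eq_right (by omega), if_pos hy, if_pos hy, if_neg (by omega), if_pos hy, if_neg (by omega),
      if_pos (by omega)]
    field_simp
    ring

noncomputable def dcU (d N : ℕ) (m : Fin d → ℕ) : CCState d (fun _ => N) → ℝ :=
  fun i => ∏ k, dcu N (m k) (i k : ℕ)

lemma dc_matrix {d : ℕ} (hd : 0 < d) (N : ℕ) (i i' : CCState d (fun _ => N)) :
    antidualCC d (fun _ => N) (fun _ => 1 / (d : ℝ)) i i' =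
      (1 / (d : ℝ)) * ∑ k, if (∀ j, j ≠ k → i' j = i j) then dcQ N (i k) (i' k) else 0 := by
  have hdR : (d : ℝ) ≠ 0 := by positivity
  have key : (if i' = i
      then 1 - ∑ j : Fin d, (if (i j : ℕ) < N
            then (1 - 1 / ((((i j : ℕ) : ℝ) + 1) * (((i j : ℕ) : ℝ) + 2))) * (1 / (d : ℝ))
            else ((N : ℝ) / ((N : ℝ) + 1)) * (1 / (d : ℝ)))
      else 0) = ∑ k, if (∀ j, j ≠ k → i' j = i j) then (if (i' k : ℕ) = i k then
        (if (i k : ℕ) < N then 1 / (((i k : ℕ) + 1 : ℝ) * ((i k : ℕ) + 2)) else 1 / ((N : ℝ) + 1))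
          * (1 / (d : ℝ)) else 0) else 0 := by
    split_ifs with h
    · subst h
      simp only [implies_true, if_true]
      have : (1 : ℝ) = ∑ j : Fin d, 1 / (d : ℝ) := by simp [hdR]
      rw [sub_eq_iff_eq_add, ← Finset.sum_add_distrib]
      refine this.trans (Finset.sum_congr rfl fun j _ => ?_)
      split_ifs
      · ring
      · field_simp
        ring
    · symm
      refine Finset.sum_eq_zero fun k _ => ?_
      by_cases h1 : ∀ j, j ≠ k → i' j = i j
      · rw [if_pos h1, if_neg]
        intro h2
        apply h
        funext j
        by_cases hj : j = k
        · subst hj; exact Fin.ext h2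
        · exact h1 j hj
      · rw [if_neg h1]
  unfold antidualCC
  rw [key, ← Finset.sum_add_distrib, ← Finset.sum_add_distrib, Finset.mul_sum]
  refine Finset.sum_congr rfl fun k _ => ?_
  by_cases h : ∀ j, j ≠ k → i' j = i j
  · simp only [and_iff_left h, if_pos h]
    unfold dcQ
    rcases lt_trichotomy (i' k : ℕ) (i k) with h1 | h1 | h1
    · have a1 : ¬ (i' k : ℕ) = i k + 1 := by omega
      have a2 : ¬ (i' k : ℕ) = i k := by omega
      have a3 : (i' k : ℕ) ≤ i k := by omega
      simp only [if_neg a1, if_pos h1, if_neg a2, if_pos a3]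
      split_ifs <;> ring
    · have a1 : ¬ (i' k : ℕ) = i k + 1 := by omega
      have a2 : ¬ (i' k : ℕ) < i k := by omega
      have a3 : (i' k : ℕ) ≤ i k := by omega
      simp only [if_neg a1, if_pos h1, if_neg a2, if_pos a3]
      split_ifs <;> ring
    · have a1 : ¬ (i' k : ℕ) < i k := by omega
      have a2 : ¬ (i' k : ℕ) = i k := by omega
      have a3 : ¬ (i' k : ℕ) ≤ i k := by omega
      simp only [if_neg a1, if_neg a2, if_neg a3]
      split_ifs <;> ring
  · rw [if_neg (fun hh => h hh.2), if_neg (fun hh => h hh.2), if_neg h, if_neg h]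
    simp

lemma dc_sum_agree {d N : ℕ} (k : Fin d) (i' : CCState d (fun _ => N))
    (F : CCState d (fun _ => N) → ℝ) :
    ∑ i, (if (∀ j, j ≠ k → i' j = i j) then F i else 0)
      = ∑ x : Fin (N + 1), F (Function.update i' k x) := by
  rw [← Finset.sum_filter]
  symm
  refine Finset.sum_bij (fun x _ => Function.update i' k x) ?_ ?_ ?_ ?_
  · intro x _
    simp only [Finset.mem_filter, Finset.mem_univ, true_and]
    intro j hj
    rw [Function.update_of_ne hj]
  · intro x _ y _ h
    have := congrFun h k
    simpa using this
  · intro i hi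
    simp only [Finset.mem_filter, Finset.mem_univ, true_and] at hi
    refine ⟨i k, Finset.mem_univ _, ?_⟩
    funext j
    by_cases hj : j = k
    · subst hj; simp
    · rw [Function.update_of_ne hj]; exact hi j hj
  · intros; rfl

lemma dc_step {d : ℕ} (hd : 0 < d) (N : ℕ) (m : Fin d → ℕ) :
    dcU d N m ᵥ* antidualCC d (fun _ => N) (fun _ => 1 / (d : ℝ)) =
      (1 / (d : ℝ)) • ∑ k, dcU d N (Function.update m k (m k + 1)) := by
  funext i'
  simp only [Matrix.vecMul, dotProduct, dc_matrix hd, Pi.smul_apply, smul_eq_mul, Finset.sum_apply]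
  have : ∀ i, dcU d N m i * ((1 / (d : ℝ)) * ∑ k, if (∀ j, j ≠ k → i' j = i j)
      then dcQ N (i k) (i' k) else 0) = (1 / (d : ℝ)) * ∑ k, if (∀ j, j ≠ k → i' j = i j)
      then dcU d N m i * dcQ N (i k) (i' k) else 0 := by
    intro i
    rw [mul_left_comm, Finset.mul_sum]
    simp only [mul_ite, mul_zero]
  simp only [this, ← Finset.mul_sum]
  rw [Finset.sum_comm]
  congr 1
  refine Finset.sum_congr rfl fun k _ => ?_
  rw [dc_sum_agree k i' (fun i => dcU d N m i * dcQ N (i k) (i' k))]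
  unfold dcU
  have e : ∀ x : Fin (N + 1), (∏ j, dcu N (m j) (Function.update i' k x j : Fin (N + 1)))
      = dcu N (m k) x * ∏ j ∈ Finset.univ.erase k, dcu N (m j) (i' j) := by
    intro x
    rw [← Finset.mul_prod_erase _ _ (Finset.mem_univ k), Function.update_self]
    congr 1
    refine Finset.prod_congr rfl fun j hj => ?_
    rw [Function.update_of_ne (Finset.ne_of_mem_erase hj)]
  rw [← Finset.mul_prod_erase _ (fun j => dcu N (Function.update m k (m k + 1) j) (i' j)) (Finset.mem_univ k), Function.update_self]
  have e2 : ∏ j ∈ Finset.univ.erase k, dcu N (Function.update m k (m k + 1) j) (i' j)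
      = ∏ j ∈ Finset.univ.erase k, dcu N (m j) (i' j) := by
    refine Finset.prod_congr rfl fun j hj => ?_
    rw [Function.update_of_ne (Finset.ne_of_mem_erase hj)]
  rw [e2, ← dc_oneD N (m k) (i' k) (Nat.lt_succ_iff.mp (i' k).2), ← Fin.sum_univ_eq_sum_range
    (fun x => dcu N (m k) x * dcQ N x (i' k)), Finset.sum_mul]
  refine Finset.sum_congr rfl fun x _ => ?_
  rw [e, Function.update_self]
  ring

lemma dc_iter {d : ℕ} (hd : 0 < d) (N n : ℕ) (i : CCState d (fun _ => N)) : ∀ m : Fin d → ℕ,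
    (dcU d N m ᵥ* (antidualCC d (fun _ => N) (fun _ => 1 / (d : ℝ))) ^ n) i
      = (dcA d)^[n] (fun m => dcU d N m i) m := by
  induction n with
  | zero => intro m; simp
  | succ n ih =>
    intro m
    rw [Function.iterate_succ_apply', pow_succ', ← Matrix.vecMul_vecMul, dc_step hd,
      Matrix.smul_vecMul, Matrix.sum_vecMul]
    simp only [Pi.smul_apply, Finset.sum_apply, ih, smul_eq_mul, dcA]

lemma dc_init (d N : ℕ) : (fun i : CCState d (fun _ => N) => if i = 0 then (1 : ℝ) else 0)
    = dcU d N 0 := by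
  funext i
  unfold dcU dcu
  split_ifs with h
  · subst h; simp
  · have : ∃ k, i k ≠ 0 := by
      by_contra hh; push Not at hh; exact h (funext hh)
    obtain ⟨k, hk⟩ := this
    symm
    apply Finset.prod_eq_zero (Finset.mem_univ k)
    rw [if_neg]
    intro h0
    apply hk
    apply Fin.ext
    simpa using h0

lemma dcU_ge (d N : ℕ) (i : CCState d (fun _ => N)) (m : Fin d → ℕ) :
    (1 / ((N : ℝ) + 1) ^ d) * dcT d N m ≤ dcU d N m i := by
  unfold dcT
  split_ifs with h
  · unfold dcU dcu
    have : ∀ k, (if (i k : ℕ) ≤ m k then 1 / ((min (m k) N : ℕ) + 1 : ℝ) else 0) = 1 / ((N : ℝ) + 1) := by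
      intro k
      rw [if_pos ((Nat.lt_succ_iff.mp (i k).2).trans (h k)), min_eq_right (h k)]
    rw [Finset.prod_congr rfl fun k _ => this k]
    simp
  · rw [mul_zero]
    exact Finset.prod_nonneg fun k _ => by unfold dcu; split_ifs <;> positivity

lemma dcU_top (d N : ℕ) (m : Fin d → ℕ) :
    dcU d N m (fun _ => Fin.last N) = (1 / ((N : ℝ) + 1) ^ d) * dcT d N m := by
  unfold dcT
  split_ifs with h
  · unfold dcU dcu
    simp [h]
  · push Not at h
    obtain ⟨k, hk⟩ := h
    rw [mul_zero]
    apply Finset.prod_eq_zero (Finset.mem_univ k)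
    simp [dcu, hk]

lemma sepN_eq {d : ℕ} (hd : 0 < d) (N n : ℕ) :
    sepN N d n = 1 - (dcA d)^[n] (dcT d N) 0 := by
  unfold sepN sep
  rw [dc_init]
  have hpos : (0 : ℝ) < 1 / ((N : ℝ) + 1) ^ d := by positivity
  apply le_antisymm
  · apply Finset.sup'_le
    intro i _
    rw [dc_iter hd]
    have := dcA_mono (dcU_ge d N i) n 0
    rw [dcA_smul] at this
    have h2 := (le_div_iff₀' hpos).mpr this
    show 1 - (dcA d)^[n] (fun m => dcU d N m i) 0 / (1 / ((N : ℝ) + 1) ^ d) ≤ _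
    linarith
  · refine le_trans (le_of_eq ?_) (Finset.le_sup' _ (Finset.mem_univ (fun _ => Fin.last N)))
    rw [dc_iter hd]
    have : (fun m => dcU d N m (fun _ => Fin.last N)) = fun m => (1 / ((N : ℝ) + 1) ^ d) * dcT d N m :=
      funext (dcU_top d N)
    rw [this, dcA_smul, mul_div_cancel_left₀ _ hpos.ne']

lemma sepN_le_one {d : ℕ} (hd : 0 < d) (N n : ℕ) : sepN N d n ≤ 1 := by
  rw [sepN_eq hd]; linarith [dcT_nonneg d N n 0]

lemma sepN_le {d : ℕ} (hd : 0 < d) (N n : ℕ) : sepN N d n ≤ d * dcG (1 / (d : ℝ)) n N := by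
  rw [sepN_eq hd]
  have := dc_lower hd N n 0
  simp at this
  simp
  linarith

lemma sepN_ge {d : ℕ} (hd : 0 < d) (N n : ℕ) :
    1 - Real.exp (- (d * dcG (1 / (d : ℝ)) n N)) ≤ sepN N d n := by
  have hdR : (0 : ℝ) < d := by exact_mod_cast hd
  have hd1 : (1 : ℝ) ≤ d := by exact_mod_cast hd
  have hp0 : 0 ≤ 1 / (d : ℝ) := by positivity
  have hp1 : 1 / (d : ℝ) ≤ 1 := by rw [div_le_one hdR]; exact hd1
  rw [sepN_eq hd]
  have := dc_upper hd N n 0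
  simp only [Pi.zero_apply, Nat.sub_zero, Finset.prod_const, Finset.card_univ, Fintype.card_fin] at this
  have h2 : (1 - dcG (1 / (d : ℝ)) n N) ^ d ≤ Real.exp (- (d * dcG (1 / (d : ℝ)) n N)) := by
    rw [← mul_neg, Real.exp_nat_mul]
    apply pow_le_pow_left₀
    · linarith [dcG_le_one hp0 hp1 n N]
    · exact Real.one_sub_le_exp_neg _
  linarith

lemma sepN_nonneg {d : ℕ} (hd : 0 < d) (N n : ℕ) : 0 ≤ sepN N d n := by
  have hdR : (0 : ℝ) < d := by exact_mod_cast hd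
  have hd1 : (1 : ℝ) ≤ d := by exact_mod_cast hd
  have hp0 : 0 ≤ 1 / (d : ℝ) := by positivity
  have hp1 : 1 / (d : ℝ) ≤ 1 := by rw [div_le_one hdR]; exact hd1
  refine le_trans ?_ (sepN_ge hd N n)
  have := dcG_nonneg hp0 hp1 n N
  have : Real.exp (- (d * dcG (1 / (d : ℝ)) n N)) ≤ 1 := by
    apply Real.exp_le_one_iff.mpr
    have := mul_nonneg hdR.le this
    linarith
  linarith

lemma dcG_upper {d : ℕ} (hd : 2 ≤ d) (M n : ℕ) (Λ : ℝ) (hΛ : 1 ≤ Λ) (h : (n : ℝ) / d ≤ Λ) :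
    dcG (1 / (d : ℝ)) n (M + 1) ≤ (M + 1) * (2 ^ M * Λ ^ M * Real.exp (-((n : ℝ) / d))) := by
  have hd2 : (2 : ℝ) ≤ d := by exact_mod_cast hd
  have hdR : (0 : ℝ) < d := by linarith
  set p := 1 / (d : ℝ) with hp
  have hp0 : 0 ≤ p := by positivity
  have hp1 : p ≤ 1 / 2 := by rw [hp]; gcongr
  have hq : 0 ≤ 1 - p := by linarith
  have key : ∀ j ∈ Finset.range (M + 1), dcB p n j ≤ 2 ^ M * Λ ^ M * Real.exp (-((n : ℝ) / d)) := by
    intro j hj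
    have hj' : j ≤ M := by simp at hj; omega
    unfold dcB
    rcases lt_or_ge n j with hnj | hnj
    · rw [Nat.choose_eq_zero_of_lt hnj]
      simp only [Nat.cast_zero, zero_mul]
      positivity
    · have h1 : (n.choose j : ℝ) * p ^ j ≤ Λ ^ M := by
        have : (n.choose j : ℝ) ≤ (n : ℝ) ^ j := by exact_mod_cast Nat.choose_le_pow n j
        calc (n.choose j : ℝ) * p ^ j ≤ (n : ℝ) ^ j * p ^ j := by gcongr
          _ = ((n : ℝ) / d) ^ j := by rw [← mul_pow, hp]; congr 1; ring
          _ ≤ Λ ^ j := by gcongr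
          _ ≤ Λ ^ M := pow_le_pow_right₀ hΛ hj'
      have h2 : (1 - p) ^ (n - j) ≤ 2 ^ M * Real.exp (-((n : ℝ) / d)) := by
        have e1 : (1 - p) ^ n ≤ Real.exp (-((n : ℝ) / d)) := by
          have : -((n : ℝ) / d) = n * (-p) := by rw [hp]; ring
          rw [this, Real.exp_nat_mul]
          exact pow_le_pow_left₀ hq (Real.one_sub_le_exp_neg _) _
        have e2 : (1 - p) ^ (n - j) ≤ 2 ^ j * (1 - p) ^ n := by
          have : (1 - p) ^ n = (1 - p) ^ (n - j) * (1 - p) ^ j := by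
            rw [← pow_add]; congr 1; omega
          rw [this]
          have e3 : (1 : ℝ) ≤ 2 ^ j * (1 - p) ^ j := by
            rw [← mul_pow]; exact one_le_pow₀ (by linarith)
          have e4 : 0 ≤ (1 - p) ^ (n - j) := by positivity
          nlinarith
        calc (1 - p) ^ (n - j) ≤ 2 ^ j * (1 - p) ^ n := e2
          _ ≤ 2 ^ M * Real.exp (-((n : ℝ) / d)) := by
            gcongr
            norm_num
      calc (n.choose j : ℝ) * p ^ j * (1 - p) ^ (n - j)
          ≤ Λ ^ M * (2 ^ M * Real.exp (-((n : ℝ) / d))) := by gcongr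
        _ = _ := by ring
  unfold dcG
  refine (Finset.sum_le_card_nsmul _ _ _ key).trans (le_of_eq ?_)
  rw [nsmul_eq_mul]; simp

lemma dcG_lower {d : ℕ} (hd : 2 ≤ d) (M n : ℕ) (Λ : ℝ) (hΛ : 0 ≤ Λ)
    (h : Λ ≤ ((n : ℝ) + 1 - M) / d) (h2 : (n : ℝ) / d / d ≤ 2) :
    Λ ^ M / M.factorial * Real.exp (-((n : ℝ) / d) - 4) ≤ dcG (1 / (d : ℝ)) n (M + 1) := by
  have hd2 : (2 : ℝ) ≤ d := by exact_mod_cast hd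
  have hdR : (0 : ℝ) < d := by linarith
  set p := 1 / (d : ℝ) with hp
  have hp0 : 0 ≤ p := by positivity
  have hp1 : p ≤ 1 / 2 := by rw [hp]; gcongr
  have hq : 0 < 1 - p := by linarith
  have h3 : Real.exp (-((n : ℝ) / d) - 4) ≤ (1 - p) ^ n := by
    have e1 : Real.exp (-p - 2 * p ^ 2) ≤ 1 - p := by
      rw [← Real.le_log_iff_exp_le hq]
      refine le_trans ?_ (Real.one_sub_inv_le_log_of_pos hq)
      rw [le_sub_iff_add_le, ← le_sub_iff_add_le', inv_le_iff_one_le_mul₀ hq]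
      nlinarith [mul_nonneg hp0 hp0]
    calc Real.exp (-((n : ℝ) / d) - 4) ≤ Real.exp (n * (-p - 2 * p ^ 2)) := by
          apply Real.exp_le_exp.mpr
          have : n * (-p - 2 * p ^ 2) = -((n : ℝ) / d) - 2 * ((n : ℝ) / d / d) := by
            rw [hp]; field_simp
          rw [this]; linarith
      _ = Real.exp (-p - 2 * p ^ 2) ^ n := Real.exp_nat_mul _ _
      _ ≤ _ := by gcongr
  have h4 : (1 - p) ^ n ≤ (1 - p) ^ (n - M) :=
    pow_le_pow_of_le_one hq.le (by linarith) (by omega)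
  have h5 : Λ ^ M / M.factorial ≤ (n.choose M : ℝ) * p ^ M := by
    have e := Nat.pow_le_choose (α := ℝ) M n
    have e1 : Λ ≤ ((n + 1 - M : ℕ) : ℝ) * p := by
      refine h.trans ?_
      rw [hp, div_eq_mul_one_div]
      gcongr
      rw [sub_le_iff_le_add]
      have : n + 1 ≤ (n + 1 - M) + M := by omega
      exact_mod_cast this
    calc Λ ^ M / M.factorial ≤ (((n + 1 - M : ℕ) : ℝ) * p) ^ M / M.factorial := by gcongr
      _ = (((n + 1 - M : ℕ) : ℝ)) ^ M / M.factorial * p ^ M := by rw [mul_pow]; ring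
      _ ≤ _ := by
        gcongr
  calc _ ≤ ((n.choose M : ℝ) * p ^ M) * (1 - p) ^ (n - M) := by
        gcongr
        exact h3.trans h4
    _ = dcB p n M := rfl
    _ ≤ _ := Finset.single_le_sum (fun j _ => dcB_nonneg hp0 (by linarith) n j)
        (Finset.mem_range.mpr (Nat.lt_succ_self M))

lemma dc_ev (M : ℕ) (K : ℝ) : ∀ᶠ d : ℕ in atTop, 2 ≤ d ∧ 1 ≤ Real.log d ∧
    (M : ℝ) * Real.log (Real.log d) + K ≤ Real.log d / 2 := by
  have hlog : Tendsto (fun d : ℕ => Real.log d) atTop atTop :=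
    Real.tendsto_log_atTop.comp tendsto_natCast_atTop_atTop
  have h1 : ∀ᶠ x : ℝ in atTop, (M : ℝ) * Real.log x + K ≤ x / 2 := by
    have := (Real.isLittleO_log_id_atTop.const_mul_left (M : ℝ)).bound (show (0 : ℝ) < 1 / 4 by norm_num)
    filter_upwards [this, eventually_ge_atTop 0, eventually_ge_atTop (4 * K)] with x hx h0 hK
    simp only [id, Real.norm_eq_abs, abs_of_nonneg h0] at hx
    linarith [le_abs_self ((M : ℝ) * Real.log x)]
  filter_upwards [eventually_ge_atTop 2, hlog.eventually_ge_atTop 1, hlog.eventually h1] with d a b c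
  exact ⟨a, b, c⟩

lemma dc_exp (M : ℕ) {d : ℕ} (hd : 2 ≤ d) (hL : 1 ≤ Real.log d) (c : ℝ) :
    Real.exp (-(Real.log d + M * Real.log (Real.log d) + c)) =
      1 / (d * Real.log d ^ M * Real.exp c) := by
  have hd2 : (2 : ℝ) ≤ d := by exact_mod_cast hd
  rw [Real.exp_neg, Real.exp_add, Real.exp_add, Real.exp_log (by linarith), Real.exp_nat_mul,
    Real.exp_log (by linarith), one_div]

lemma dc_main_upper (M : ℕ) (c : ℝ) : ∀ᶠ d : ℕ in atTop,
    sepN (M + 1) d ⌈(d : ℝ) * Real.log d + (((M + 1 : ℕ) : ℝ) - 1) * d * Real.log (Real.log d) + c * d⌉₊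
      ≤ (M + 1) * 2 ^ M * 2 ^ M * Real.exp (-c) := by
  filter_upwards [dc_ev M (|c| + 1)] with d hd
  obtain ⟨hd, hL, hK⟩ := hd
  have hd2 : (2 : ℝ) ≤ d := by exact_mod_cast hd
  have hdR : (0 : ℝ) < d := by linarith
  set L := Real.log d with hLdef
  have hLL : 0 ≤ (M : ℝ) * Real.log L := mul_nonneg (by positivity) (Real.log_nonneg hL)
  have eq : (d : ℝ) * L + (((M + 1 : ℕ) : ℝ) - 1) * d * Real.log L + c * d
      = (L + M * Real.log L + c) * d := by push_cast; ring
  rw [eq]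
  set τ := L + M * Real.log L + c with hτ
  set n := ⌈τ * d⌉₊ with hn
  have hτ0 : 0 ≤ τ := by linarith [neg_abs_le c]
  have n1 : τ ≤ (n : ℝ) / d := by rw [le_div_iff₀ hdR]; exact Nat.le_ceil _
  have n2 : (n : ℝ) / d ≤ 2 * L := by
    rw [div_le_iff₀ hdR]
    have := (Nat.ceil_lt_add_one (show 0 ≤ τ * d by positivity)).le
    have h3 : τ + 1 ≤ 2 * L := by linarith [le_abs_self c]
    nlinarith
  refine (sepN_le (by omega) _ _).trans ?_
  have := dcG_upper hd M n (2 * L) (by linarith) n2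
  calc (d : ℝ) * dcG (1 / (d : ℝ)) n (M + 1)
      ≤ d * ((M + 1) * (2 ^ M * (2 * L) ^ M * Real.exp (-((n : ℝ) / d)))) := by gcongr
    _ ≤ d * ((M + 1) * (2 ^ M * (2 * L) ^ M * Real.exp (-τ))) := by gcongr
    _ = _ := by
      rw [hτ, dc_exp M hd hL c, ← hLdef, mul_pow, Real.exp_neg]
      have : L ^ M ≠ 0 := by positivity
      field_simp

lemma dc_main_lower (M : ℕ) (c : ℝ) : ∀ᶠ d : ℕ in atTop,
    1 - Real.exp (-(Real.exp c * (Real.exp (-4) / (2 ^ M * M.factorial)))) ≤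
    sepN (M + 1) d ⌊(d : ℝ) * Real.log d + (((M + 1 : ℕ) : ℝ) - 1) * d * Real.log (Real.log d) - c * d⌋₊ := by
  filter_upwards [dc_ev M (|c| + M + 1)] with d hd
  obtain ⟨hd, hL, hK⟩ := hd
  have hd2 : (2 : ℝ) ≤ d := by exact_mod_cast hd
  have hdR : (0 : ℝ) < d := by linarith
  have hLd : Real.log d ≤ d := (Real.log_le_sub_one_of_pos hdR).trans (by linarith)
  set L := Real.log d with hLdef
  have hLL : 0 ≤ (M : ℝ) * Real.log L := mul_nonneg (by positivity) (Real.log_nonneg hL)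
  have eq : (d : ℝ) * L + (((M + 1 : ℕ) : ℝ) - 1) * d * Real.log L - c * d
      = (L + M * Real.log L + -c) * d := by push_cast; ring
  rw [eq]
  set τ := L + M * Real.log L + -c with hτ
  set n := ⌊τ * d⌋₊ with hn
  have hM0 : (0 : ℝ) ≤ M := by positivity
  have hτ0 : 0 ≤ τ := by linarith [le_abs_self c]
  have n1 : (n : ℝ) / d ≤ τ := by rw [div_le_iff₀ hdR]; exact Nat.floor_le (by positivity)
  have n2 : L / 2 ≤ ((n : ℝ) + 1 - M) / d := by
    rw [le_div_iff₀ hdR]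
    have := (Nat.lt_floor_add_one (τ * d)).le
    have h3 : L / 2 + M ≤ τ := by linarith [le_abs_self c]
    nlinarith
  have n3 : (n : ℝ) / d / d ≤ 2 := by
    rw [div_le_iff₀ hdR]
    linarith [neg_abs_le c]
  refine le_trans ?_ (sepN_ge (by omega) _ _)
  have := dcG_lower hd M n (L / 2) (by linarith) n2 n3
  refine sub_le_sub_left (Real.exp_le_exp.mpr (neg_le_neg ?_)) _
  calc Real.exp c * (Real.exp (-4) / (2 ^ M * M.factorial))
      = d * ((L / 2) ^ M / M.factorial * (Real.exp (-τ) * Real.exp (-4))) := by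
        rw [hτ, dc_exp M hd hL, ← hLdef, div_pow, Real.exp_neg c]
        have : L ^ M ≠ 0 := by positivity
        field_simp
    _ ≤ d * ((L / 2) ^ M / M.factorial * Real.exp (-((n : ℝ) / d) - 4)) := by
        rw [← Real.exp_add]
        gcongr
        linarith
    _ ≤ _ := by gcongr

/-- Separation cutoff at time `d log d + (N−1) d log log d` with window size `d`
for the double Dixie cup antidual chains. -/
theorem stmt14 (N : ℕ) (hN : 2 ≤ N) :
    Tendsto (fun c : ℝ =>
        limsup (fun d : ℕ => sepN N d
          ⌈(d : ℝ) * Real.log d + ((N : ℝ) - 1) * d * Real.log (Real.log d) + c * d⌉₊)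
          atTop)
      atTop (nhds 0) ∧
    Tendsto (fun c : ℝ =>
        liminf (fun d : ℕ => sepN N d
          ⌊(d : ℝ) * Real.log d + ((N : ℝ) - 1) * d * Real.log (Real.log d) - c * d⌋₊)
          atTop)
      atTop (nhds 1) := by
  obtain ⟨M, rfl⟩ : ∃ M, N = M + 1 := ⟨N - 1, by omega⟩
  constructor
  · have lim : Tendsto (fun c : ℝ => ((M : ℝ) + 1) * 2 ^ M * 2 ^ M * Real.exp (-c)) atTop (nhds 0) := by
      have := Real.tendsto_exp_neg_atTop_nhds_zero.const_mul (((M : ℝ) + 1) * 2 ^ M * 2 ^ M)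
      simpa using this
    refine squeeze_zero (fun c => ?_) (fun c => ?_) lim
    · refine le_limsup_of_frequently_le (Eventually.frequently ?_) ?_
      · filter_upwards [eventually_gt_atTop 0] with d hd
        exact sepN_nonneg hd _ _
      · exact isBoundedUnder_of_eventually_le (dc_main_upper M c)
    · refine limsup_le_of_le ?_ (dc_main_upper M c)
      refine IsBoundedUnder.isCoboundedUnder_le (isBoundedUnder_of_eventually_ge (a := 0) ?_)
      filter_upwards [eventually_gt_atTop 0] with d hd
      exact sepN_nonneg hd _ _
  · have hK : 0 < Real.exp (-4) / (2 ^ M * (M.factorial : ℝ)) := by positivity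
    have lim : Tendsto (fun c : ℝ => 1 - Real.exp (-(Real.exp c * (Real.exp (-4) / (2 ^ M * M.factorial)))))
        atTop (nhds 1) := by
      have h1 := Real.tendsto_exp_neg_atTop_nhds_zero.comp (Real.tendsto_exp_atTop.atTop_mul_const hK)
      have h2 := h1.const_sub 1
      simpa [Function.comp_def] using h2
    have hle : ∀ c : ℝ, ∀ᶠ d : ℕ in atTop, sepN (M + 1) d
        ⌊(d : ℝ) * Real.log d + (((M + 1 : ℕ) : ℝ) - 1) * d * Real.log (Real.log d) - c * d⌋₊ ≤ 1 := by
      intro c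
      filter_upwards [eventually_gt_atTop 0] with d hd
      exact sepN_le_one hd _ _
    refine tendsto_of_tendsto_of_tendsto_of_le_of_le lim tendsto_const_nhds (fun c => ?_) (fun c => ?_)
    · refine le_liminf_of_le ?_ (dc_main_lower M c)
      exact IsBoundedUnder.isCoboundedUnder_ge (isBoundedUnder_of_eventually_le (hle c))
    · refine liminf_le_of_frequently_le (hle c).frequently ?_
      exact isBoundedUnder_of_eventually_ge (dc_main_lower M c)
end
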